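/- Let q > 1 and let Ω_t, t ∈ [0,T), be a smooth solution of the normalized Gauss curvature flow with p = 0, i.e. ∂h/∂t = −θ(t) 𝒦 f / Ṽ_{γ,q}(Ω_t, ∇h + hx) + h with θ(t) = (∫_{S^{n−1}} Ṽ_{γ,q}(Ω_t, ρ(ξ,t)ξ) ρ(ξ,t)ⁿ dξ)/(∫_{S^{n−1}} f(x) dx) (with f a positive smooth even function on S^{n−1}). Then Φ(Ω_t) = ∫_{S^{n−1}} f(x) log h(x,t) dx is non-increasing in t; equality at some time t holds if and only if h(·,t) satisfies τ₂ Ṽ_{γ,q}(Ω_t, ∇h + hx) h det(∇²h + hI) = f on S^{n−1} with τ₂ = 1/θ(t). -/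

import Mathlib

open MeasureTheory Filter
open scoped RealInnerProductSpace Topology

noncomputable section

/-- `n`-dimensional Euclidean space. -/
abbrev Eucl (n : ℕ) := EuclideanSpace ℝ (Fin n)

/-- The support function of `K`, as a `1`-homogeneous function on all of `ℝⁿ`;
its restriction to the unit sphere is the usual support function `h_K`. -/
def suppFun {n : ℕ} (K : Set (Eucl n)) (x : Eucl n) : ℝ :=
  sSup ((fun y => ⟪x, y⟫) '' K)

/-- The radial function `ρ_K(ξ) = max {c > 0 : c • ξ ∈ K}`. -/
def radFun {n : ℕ} (K : Set (Eucl n)) (ξ : Eucl n) : ℝ :=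
  sSup {c : ℝ | 0 < c ∧ c • ξ ∈ K}

/-- `Ṽ_{γ,q}(K, y) = 2 e^{-|y|²/2} ∫_K e^{-|z|²/2} |z - y|^{-(n-q+1)} dz`. -/
def Vtilde {n : ℕ} (q : ℝ) (K : Set (Eucl n)) (y : Eucl n) : ℝ :=
  2 * Real.exp (-‖y‖ ^ 2 / 2) *
    ∫ z in K, Real.exp (-‖z‖ ^ 2 / 2) / ‖z - y‖ ^ ((n : ℝ) - q + 1)

/-- The Gaussian chord integral
`I_{γ,q}(K) = ∫_K ∫_K e^{-(|z|²+|y|²)/2} |z - y|^{-(n-q+1)} dz dy`. -/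
def gaussChord {n : ℕ} (q : ℝ) (K : Set (Eucl n)) : ℝ :=
  ∫ y in K, ∫ z in K,
    Real.exp (-(‖z‖ ^ 2 + ‖y‖ ^ 2) / 2) / ‖z - y‖ ^ ((n : ℝ) - q + 1)

/-- The rank-one map `v ↦ ⟪x, v⟫ • x` (orthogonal projection onto `ℝ x` when `‖x‖ = 1`). -/
def rankOne {n : ℕ} (x : Eucl n) : Eucl n →ₗ[ℝ] Eucl n where
  toFun v := ⟪x, v⟫ • x
  map_add' v w := by simp [inner_add_right, add_smul]
  map_smul' c v := by simp [inner_smul_right, mul_smul]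

/-- For the `1`-homogeneous extension `H` of the support function `h` of a smooth strictly
convex body, `fderiv ℝ (gradient H) x` vanishes on `ℝ x` and restricts on the tangent space
`x^⊥` to the matrix of principal radii of curvature `∇²h + h I`.  Adding the rank-one
projection onto `ℝ x` therefore makes the determinant of the ambient map equal to
`det(∇²h + h I)`, the reciprocal Gauss curvature. -/
def curvDet {n : ℕ} (H : Eucl n → ℝ) (x : Eucl n) : ℝ :=
  LinearMap.det
    ((fderiv ℝ (fun y => gradient H y) x : Eucl n →ₗ[ℝ] Eucl n) + rankOne x)

/-- A convex body in `ℝⁿ` which is origin-symmetric and has smooth, strictly convex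
boundary (encoded via smoothness of its support function away from the origin and
positivity of the curvature determinant on the sphere). -/
def IsSmoothBody {n : ℕ} (Ω : Set (Eucl n)) : Prop :=
  IsCompact Ω ∧ Convex ℝ Ω ∧ (0 : Eucl n) ∈ interior Ω ∧ (∀ x ∈ Ω, -x ∈ Ω) ∧
    ContDiffOn ℝ (⊤ : ℕ∞) (suppFun Ω) {(0 : Eucl n)}ᶜ ∧
    ∀ x ∈ Metric.sphere (0 : Eucl n) 1, 0 < curvDet (suppFun Ω) x

/-- The normalizing factor
`θ(t) = (∫_{S^{n-1}} Ṽ_{γ,q}(Ω, ρ(ξ)ξ) ρ(ξ)ⁿ dξ) / (∫_{S^{n-1}} h(x)^p f(x) dx)`. -/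
def theta {n : ℕ} (q p : ℝ) (f : Eucl n → ℝ) (K : Set (Eucl n)) : ℝ :=
  (∫ ξ in Metric.sphere (0 : Eucl n) 1,
      Vtilde q K (radFun K ξ • ξ) * radFun K ξ ^ n ∂μH[(n : ℝ) - 1]) /
  ∫ x in Metric.sphere (0 : Eucl n) 1, suppFun K x ^ p * f x ∂μH[(n : ℝ) - 1]

/-- The right-hand side `-θ h^p 𝒦 f / Ṽ_{γ,q}(K, ∇h + h x) + h` of the normalized Gauss
curvature flow, expressed through the `1`-homogeneous extension of the support function
(`gradient (suppFun K) x = ∇h(x) + h(x) x` and `𝒦 = (curvDet (suppFun K) x)⁻¹`). -/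
def flowRHS {n : ℕ} (q p : ℝ) (f : Eucl n → ℝ) (K : Set (Eucl n)) (x : Eucl n) : ℝ :=
  -(theta q p f K) * suppFun K x ^ p * (curvDet (suppFun K) x)⁻¹ * f x /
      Vtilde q K (gradient (suppFun K) x) + suppFun K x

/-- `K : ℝ → Set (Eucl n)` solves the normalized Gauss curvature flow
`∂h/∂t = -θ(t) h^p 𝒦 f / Ṽ_{γ,q} + h` on the time set `S`. -/
def IsGaussChordFlow {n : ℕ} (q p : ℝ) (f : Eucl n → ℝ) (S : Set ℝ)
    (K : ℝ → Set (Eucl n)) : Prop :=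
  ∀ t ∈ S, ∀ x ∈ Metric.sphere (0 : Eucl n) 1,
    HasDerivWithinAt (fun s => suppFun (K s) x) (flowRHS q p f (K t) x) S t

/-- The Wulff shape (Aleksandrov body) of a function `φ` on the unit sphere. -/
def wulff {n : ℕ} (φ : Eucl n → ℝ) : Set (Eucl n) :=
  {x | ∀ u ∈ Metric.sphere (0 : Eucl n) 1, ⟪x, u⟫ ≤ φ u}

/-- `ν` is a Gauss map of `∂K`: at every boundary point `y` of `K`, `ν y` is an outer
unit normal, i.e. `y · ν y = h_K(ν y)`. -/
def IsGaussMap {n : ℕ} (K : Set (Eucl n)) (ν : Eucl n → Eucl n) : Prop :=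
  ∀ y ∈ frontier K, ν y ∈ Metric.sphere (0 : Eucl n) 1 ∧ ⟪y, ν y⟫ = suppFun K (ν y)

section SupportFunction

variable {n : ℕ} {K : Set (Eucl n)}

lemma bddAbove_inner_image (hK : IsCompact K) (x : Eucl n) :
    BddAbove ((fun y => ⟪x, y⟫) '' K) :=
  (hK.image (by fun_prop)).bddAbove

lemma inner_le_suppFun (hK : IsCompact K) (x : Eucl n) {y : Eucl n} (hy : y ∈ K) :
    ⟪x, y⟫ ≤ suppFun K x :=
  le_csSup (bddAbove_inner_image hK x) ⟨y, hy, rfl⟩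

lemma exists_inner_eq_suppFun (hK : IsCompact K) (hne : K.Nonempty) (x : Eucl n) :
    ∃ y ∈ K, ⟪x, y⟫ = suppFun K x := by
  have h := (hK.image (f := fun y => ⟪x, y⟫) (by fun_prop)).sSup_mem (hne.image _)
  obtain ⟨y, hy, h⟩ := h
  exact ⟨y, hy, h⟩

lemma suppFun_smul (hK : IsCompact K) (hne : K.Nonempty) {c : ℝ} (hc : 0 ≤ c) (x : Eucl n) :
    suppFun K (c • x) = c * suppFun K x := by
  apply le_antisymm
  · obtain ⟨y, hy, h⟩ := exists_inner_eq_suppFun hK hne (c • x)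
    rw [← h, inner_smul_left]
    exact mul_le_mul_of_nonneg_left (inner_le_suppFun hK x hy) hc
  · obtain ⟨y, hy, h⟩ := exists_inner_eq_suppFun hK hne x
    have := inner_le_suppFun hK (c • x) hy
    rw [inner_smul_left] at this
    rw [← h]
    exact this

lemma exists_closedBall_subset (h0 : (0 : Eucl n) ∈ interior K) :
    ∃ r > 0, Metric.closedBall (0 : Eucl n) r ⊆ K :=
  Metric.nhds_basis_closedBall.mem_iff.1 (mem_interior_iff_mem_nhds.1 h0)

lemma mul_norm_le_suppFun (hK : IsCompact K) {r : ℝ} (hr : 0 ≤ r)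
    (hrK : Metric.closedBall (0 : Eucl n) r ⊆ K) (x : Eucl n) : r * ‖x‖ ≤ suppFun K x := by
  rcases eq_or_ne x 0 with rfl | hx
  · have := inner_le_suppFun hK (0 : Eucl n) (hrK (Metric.mem_closedBall_self hr))
    simpa using this
  · have hx' : ‖x‖ ≠ 0 := norm_ne_zero_iff.2 hx
    have := inner_le_suppFun hK x (y := (r / ‖x‖) • x) (hrK (by
      rw [mem_closedBall_zero_iff, norm_smul, Real.norm_of_nonneg (by positivity)]
      field_simp; rfl))
    rw [inner_smul_right, real_inner_self_eq_norm_sq] at this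
    calc r * ‖x‖ = r / ‖x‖ * ‖x‖ ^ 2 := by field_simp
      _ ≤ _ := this

lemma suppFun_pos (hK : IsCompact K) (h0 : (0 : Eucl n) ∈ interior K) {x : Eucl n} (hx : x ≠ 0) :
    0 < suppFun K x := by
  obtain ⟨r, hr, hrK⟩ := exists_closedBall_subset h0
  exact lt_of_lt_of_le (by positivity) (mul_norm_le_suppFun hK hr.le hrK x)

lemma suppFun_le_add (hK : IsCompact K) (hne : K.Nonempty) {R : ℝ}
    (hR : K ⊆ Metric.closedBall 0 R) (x y : Eucl n) :
    suppFun K x ≤ suppFun K y + R * ‖x - y‖ := by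
  obtain ⟨z, hz, h⟩ := exists_inner_eq_suppFun hK hne x
  have h1 := inner_le_suppFun hK y hz
  have h2 : ⟪x - y, z⟫ ≤ ‖x - y‖ * ‖z‖ := real_inner_le_norm _ _
  have h3 : ‖z‖ ≤ R := by simpa using hR hz
  rw [inner_sub_left] at h2
  nlinarith [norm_nonneg (x - y)]

lemma gradient_eq_of_forall_inner_le {E : Eucl n → ℝ} {x y : Eucl n}
    (hd : DifferentiableAt ℝ E x) (hle : ∀ z, ⟪z, y⟫ ≤ E z) (heq : ⟪x, y⟫ = E x) :
    gradient E x = y := by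
  have hmin : IsLocalMin (fun z => E z - ⟪y, z⟫) x := by
    refine Filter.Eventually.of_forall fun z => ?_
    have := hle z
    simp only
    rw [real_inner_comm x y, real_inner_comm z y, heq]
    linarith
  have hdi : HasFDerivAt (fun z : Eucl n => ⟪y, z⟫) (innerSL ℝ y) x :=
    (innerSL ℝ y).hasFDerivAt
  have h := sub_eq_zero.1 (hmin.hasFDerivAt_eq_zero (hd.hasFDerivAt.sub hdi))
  rw [gradient, h]
  exact (InnerProductSpace.toDual ℝ (Eucl n)).symm_apply_apply y

end SupportFunction

section SecondDerivative

variable {n : ℕ}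

lemma inner_gradient_left' (E : Eucl n → ℝ) (z v : Eucl n) :
    ⟪gradient E z, v⟫ = fderiv ℝ E z v :=
  InnerProductSpace.toDual_symm_apply

lemma contDiffAt_gradient {E : Eucl n → ℝ} {x : Eucl n} {m k : WithTop ℕ∞}
    (hE : ContDiffAt ℝ k E x) (hmk : m + 1 ≤ k) : ContDiffAt ℝ m (gradient E) x :=
  (InnerProductSpace.toDual ℝ (Eucl n)).symm.contDiff.contDiffAt.comp x
    (hE.fderiv_right hmk)

lemma differentiableAt_gradient {E : Eucl n → ℝ} {x : Eucl n} (hE : ContDiffAt ℝ 2 E x) :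
    DifferentiableAt ℝ (gradient E) x :=
  (contDiffAt_gradient (m := 1) hE (by norm_num)).differentiableAt one_ne_zero

lemma inner_fderiv_gradient {E : Eucl n → ℝ} {x : Eucl n} (hE : ContDiffAt ℝ 2 E x)
    (v w : Eucl n) : ⟪fderiv ℝ (gradient E) x v, w⟫ = fderiv ℝ (fderiv ℝ E) x v w := by
  have h1 : DifferentiableAt ℝ (fderiv ℝ E) x :=
    (hE.fderiv_right (m := 1) (by norm_num)).differentiableAt one_ne_zero
  let L : (Eucl n →L[ℝ] ℝ) →L[ℝ] Eucl n :=
    ((InnerProductSpace.toDual ℝ (Eucl n)).symm.toContinuousLinearEquiv : _ →L⋆[ℝ] Eucl n)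
  have h2 : HasFDerivAt (gradient E) (L.comp (fderiv ℝ (fderiv ℝ E) x)) x :=
    L.hasFDerivAt.comp x h1.hasFDerivAt
  rw [h2.fderiv]
  exact InnerProductSpace.toDual_symm_apply

lemma isSymmetric_fderiv_gradient {E : Eucl n → ℝ} {x : Eucl n} (hE : ContDiffAt ℝ 2 E x) :
    (fderiv ℝ (gradient E) x : Eucl n →ₗ[ℝ] Eucl n).IsSymmetric := by
  intro v w
  have := (hE.isSymmSndFDerivAt (by simp)) v w
  simp only [ContinuousLinearMap.coe_coe]
  rw [inner_fderiv_gradient hE, this, ← inner_fderiv_gradient hE, real_inner_comm]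

lemma fderiv_gradient_nonneg_of_isLocalMin {E : Eucl n → ℝ} {x : Eucl n}
    (hE : ContDiffAt ℝ 2 E x) (hmin : IsLocalMin E x) (v : Eucl n) :
    0 ≤ ⟪fderiv ℝ (gradient E) x v, v⟫ := by
  set φ : ℝ → ℝ := fun τ => E (x + τ • v) with hφ
  have hline : ∀ τ : ℝ, HasDerivAt (fun τ : ℝ => x + τ • v) v τ := fun τ => by
    simpa using ((hasDerivAt_id τ).smul_const v).const_add x
  have hc : Tendsto (fun τ : ℝ => x + τ • v) (𝓝 0) (𝓝 x) := by
    simpa using (hline 0).continuousAt.tendsto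
  have hd : ∀ᶠ z in 𝓝 x, DifferentiableAt ℝ E z := by
    filter_upwards [hE.eventually (by simp)] with z hz
    exact hz.differentiableAt two_ne_zero
  have hφ' : ∀ᶠ τ in 𝓝 (0 : ℝ), deriv φ τ = ⟪gradient E (x + τ • v), v⟫ := by
    filter_upwards [hc.eventually hd] with τ hτ
    rw [inner_gradient_left']
    exact (hτ.hasFDerivAt.comp_hasDerivAt τ (hline τ)).deriv
  have hφ'' : deriv (deriv φ) 0 = ⟪fderiv ℝ (gradient E) x v, v⟫ := by
    rw [Filter.EventuallyEq.deriv_eq hφ']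
    have h1 : HasFDerivAt (gradient E) (fderiv ℝ (gradient E) x) (x + (0 : ℝ) • v) := by
      simpa using (differentiableAt_gradient hE).hasFDerivAt
    have h2 := (h1.comp_hasDerivAt (0 : ℝ) (hline 0)).inner ℝ (hasDerivAt_const (0 : ℝ) v)
    simpa using h2.deriv
  have hmin' : IsLocalMin φ 0 := by
    have : ∀ᶠ τ in 𝓝 (0 : ℝ), E x ≤ E (x + τ • v) := hc.eventually hmin
    simpa [IsLocalMin, IsMinFilter, hφ] using this
  by_contra! hneg
  rw [← hφ''] at hneg
  have hcont : ContinuousAt φ 0 := by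
    have : ContinuousAt E (x + (0 : ℝ) • v) := by simpa using hE.continuousAt
    exact ContinuousAt.comp (f := fun τ : ℝ => x + τ • v) this (hline 0).continuousAt
  have hmax : IsLocalMin (-φ) 0 := by
    apply isLocalMin_of_deriv_deriv_pos
    · have h1 : deriv (-φ) = -deriv φ := by ext; simp
      rw [h1]
      simpa using hneg
    · simp [hmin'.deriv_eq_zero]
    · exact hcont.neg
  have hconst : φ =ᶠ[𝓝 0] fun _ => φ 0 := by
    filter_upwards [hmin', hmax] with τ h1 h2
    simp only [Pi.neg_apply, neg_le_neg_iff] at h2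
    exact le_antisymm h2 h1
  have := hconst.deriv.deriv_eq
  simp at this
  exact hneg.ne this

end SecondDerivative

section Determinant

lemma Matrix.PosSemidef.one_le_det_one_add {ι : Type*} [Fintype ι] [DecidableEq ι]
    {C : Matrix ι ι ℝ} (hC : C.PosSemidef) : 1 ≤ (1 + C).det := by
  have hH : (1 + C).IsHermitian := Matrix.isHermitian_one.add hC.isHermitian
  rw [hH.det_eq_prod_eigenvalues]
  refine Finset.one_le_prod fun i _ => ?_
  have h1 := hH.eigenvalues_eq i
  have h2 := hC.re_dotProduct_nonneg (hH.eigenvectorBasis i)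
  have h3 : ‖hH.eigenvectorBasis i‖ = 1 := hH.eigenvectorBasis.orthonormal.1 i
  have h4 : ⟪hH.eigenvectorBasis i, hH.eigenvectorBasis i⟫ = 1 := by
    rw [real_inner_self_eq_norm_sq, h3, one_pow]
  rw [EuclideanSpace.inner_eq_star_dotProduct, dotProduct_comm] at h4
  rw [Matrix.add_mulVec, Matrix.one_mulVec, dotProduct_add, h4] at h1
  simp only [RCLike.ofReal_real_eq_id, id_eq, RCLike.re_to_real] at h1 h2 ⊢
  linarith

open scoped MatrixOrder in
lemma Matrix.PosDef.det_le_det_add {ι : Type*} [Fintype ι] [DecidableEq ι]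
    {A C : Matrix ι ι ℝ} (hA : A.PosDef) (hC : C.PosSemidef) : A.det ≤ (A + C).det := by
  obtain ⟨B, hB⟩ : ∃ B : Matrix ι ι ℝ, A = B.conjTranspose * B :=
    CStarAlgebra.nonneg_iff_eq_star_mul_self.1 hA.posSemidef.nonneg
  have hdet : A.det = B.det * B.det := by rw [hB, Matrix.det_mul, Matrix.det_conjTranspose]; simp
  have hBu : IsUnit B.det := by
    rw [isUnit_iff_ne_zero]
    intro h
    exact hA.det_pos.ne' (by rw [hdet, h, zero_mul])
  have hBB : B⁻¹ * B = 1 := Matrix.nonsing_inv_mul B hBu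
  have hBH : B.conjTranspose * (B⁻¹).conjTranspose = 1 := by
    rw [← Matrix.conjTranspose_mul, hBB, Matrix.conjTranspose_one]
  have hsum : A + C = B.conjTranspose * (1 + (B⁻¹).conjTranspose * C * B⁻¹) * B := by
    have h5 : B.conjTranspose * ((B⁻¹).conjTranspose * C * B⁻¹) * B = C := by
      calc _ = (B.conjTranspose * (B⁻¹).conjTranspose) * C * (B⁻¹ * B) := by
            simp only [Matrix.mul_assoc]
        _ = C := by rw [hBB, hBH, Matrix.one_mul, Matrix.mul_one]
    rw [mul_add, add_mul, mul_one, h5, hB]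
  have h1 := (hC.conjTranspose_mul_mul_same B⁻¹).one_le_det_one_add
  have h2 : (A + C).det = B.det * B.det * (1 + (B⁻¹).conjTranspose * C * B⁻¹).det := by
    rw [hsum, Matrix.det_mul, Matrix.det_mul, Matrix.det_conjTranspose]
    simp only [star_trivial]
    ring
  rw [h2, hdet]
  exact le_mul_of_one_le_right (mul_self_nonneg _) h1

variable {E : Type*} [NormedAddCommGroup E] [InnerProductSpace ℝ E] [FiniteDimensional ℝ E]

lemma LinearMap.IsPositive.det_le_det_add {A C : E →ₗ[ℝ] E} (hA : A.IsPositive)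
    (hdet : LinearMap.det A ≠ 0) (hC : C.IsPositive) :
    LinearMap.det A ≤ LinearMap.det (A + C) := by
  classical
  set b := stdOrthonormalBasis ℝ E
  have hA' := (LinearMap.posSemidef_toMatrix_iff b).2 hA
  rw [← LinearMap.det_toMatrix b.toBasis] at hdet
  have := (hA'.posDef_iff_det_ne_zero.2 hdet).det_le_det_add
    ((LinearMap.posSemidef_toMatrix_iff b).2 hC)
  rwa [← map_add, LinearMap.det_toMatrix, LinearMap.det_toMatrix] at this

lemma det_id_add_smulRight (f : E →ₗ[ℝ] ℝ) (v : E) :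
    LinearMap.det (LinearMap.id + f.smulRight v) = 1 + f v :=
  LinearMap.transvection.det f v

end Determinant

section SmoothBody

variable {n : ℕ} {K : Set (Eucl n)}

namespace IsSmoothBody

lemma isCompact (hK : IsSmoothBody K) : IsCompact K := hK.1

lemma convex (hK : IsSmoothBody K) : Convex ℝ K := hK.2.1

lemma zero_mem_interior (hK : IsSmoothBody K) : (0 : Eucl n) ∈ interior K := hK.2.2.1

lemma nonempty (hK : IsSmoothBody K) : K.Nonempty := ⟨0, interior_subset hK.zero_mem_interior⟩

lemma curvDet_pos (hK : IsSmoothBody K) {x : Eucl n} (hx : x ∈ Metric.sphere (0 : Eucl n) 1) :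
    0 < curvDet (suppFun K) x := hK.2.2.2.2.2 x hx

lemma suppFun_pos (hK : IsSmoothBody K) {x : Eucl n} (hx : x ≠ 0) : 0 < suppFun K x :=
  _root_.suppFun_pos hK.isCompact hK.zero_mem_interior hx

lemma contDiffAt (hK : IsSmoothBody K) {x : Eucl n} (hx : x ≠ 0) :
    ContDiffAt ℝ (⊤ : ℕ∞) (suppFun K) x :=
  hK.2.2.2.2.1.contDiffAt (isOpen_compl_singleton.mem_nhds hx)

lemma contDiffAt_two (hK : IsSmoothBody K) {x : Eucl n} (hx : x ≠ 0) :
    ContDiffAt ℝ 2 (suppFun K) x :=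
  (hK.contDiffAt hx).of_le (WithTop.coe_le_coe.2 (le_top : (2 : ℕ∞) ≤ ⊤))

lemma gradient_eq (hK : IsSmoothBody K) {x y : Eucl n} (hx : x ≠ 0) (hy : y ∈ K)
    (h : ⟪x, y⟫ = suppFun K x) : gradient (suppFun K) x = y :=
  gradient_eq_of_forall_inner_le ((hK.contDiffAt_two hx).differentiableAt two_ne_zero)
    (fun z => inner_le_suppFun hK.isCompact z hy) h

lemma gradient_mem (hK : IsSmoothBody K) {x : Eucl n} (hx : x ≠ 0) :
    gradient (suppFun K) x ∈ K := by
  obtain ⟨y, hy, h⟩ := exists_inner_eq_suppFun hK.isCompact hK.nonempty x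
  rwa [hK.gradient_eq hx hy h]

lemma inner_gradient (hK : IsSmoothBody K) {x : Eucl n} (hx : x ≠ 0) :
    ⟪x, gradient (suppFun K) x⟫ = suppFun K x := by
  obtain ⟨y, hy, h⟩ := exists_inner_eq_suppFun hK.isCompact hK.nonempty x
  rwa [hK.gradient_eq hx hy h]

lemma gradient_ne_zero (hK : IsSmoothBody K) {x : Eucl n} (hx : x ≠ 0) :
    gradient (suppFun K) x ≠ 0 := by
  intro h
  have := hK.inner_gradient hx
  rw [h, inner_zero_right] at this
  exact (hK.suppFun_pos hx).ne this

lemma gradient_smul (hK : IsSmoothBody K) {x : Eucl n} (hx : x ≠ 0) {c : ℝ} (hc : 0 < c) :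
    gradient (suppFun K) (c • x) = gradient (suppFun K) x := by
  refine hK.gradient_eq (smul_ne_zero hc.ne' hx) (hK.gradient_mem hx) ?_
  rw [inner_smul_left, hK.inner_gradient hx, suppFun_smul hK.isCompact hK.nonempty hc.le]
  simp

lemma contDiffAt_gradient (hK : IsSmoothBody K) {x : Eucl n} (hx : x ≠ 0) :
    ContDiffAt ℝ 2 (gradient (suppFun K)) x :=
  _root_.contDiffAt_gradient (hK.contDiffAt hx)
    (WithTop.coe_le_coe.2 (le_top : (2 + 1 : ℕ∞) ≤ ⊤))

lemma differentiableAt_gradient (hK : IsSmoothBody K) {x : Eucl n} (hx : x ≠ 0) :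
    DifferentiableAt ℝ (gradient (suppFun K)) x :=
  (hK.contDiffAt_gradient hx).differentiableAt two_ne_zero

lemma continuousOn_gradient (hK : IsSmoothBody K) :
    ContinuousOn (gradient (suppFun K)) {(0 : Eucl n)}ᶜ :=
  fun _ hx => (hK.contDiffAt_gradient hx).continuousAt.continuousWithinAt

lemma fderiv_gradient_self (hK : IsSmoothBody K) {x : Eucl n} (hx : x ≠ 0) :
    fderiv ℝ (gradient (suppFun K)) x x = 0 := by
  have hline : HasDerivAt (fun τ : ℝ => τ • x) x 1 := by
    simpa using (hasDerivAt_id (1 : ℝ)).smul_const x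
  have h1 : HasFDerivAt (gradient (suppFun K)) (fderiv ℝ (gradient (suppFun K)) x)
      ((1 : ℝ) • x) := by
    simpa using (hK.differentiableAt_gradient hx).hasFDerivAt
  have h2 := h1.comp_hasDerivAt (1 : ℝ) hline
  have h3 : gradient (suppFun K) ∘ (fun τ : ℝ => τ • x) =ᶠ[𝓝 1]
      fun _ => gradient (suppFun K) x := by
    filter_upwards [lt_mem_nhds (zero_lt_one (α := ℝ))] with τ hτ
    exact hK.gradient_smul hx hτ
  exact h2.unique ((hasDerivAt_const _ _).congr_of_eventuallyEq h3)

lemma fderiv_gradient_smul (hK : IsSmoothBody K) {x : Eucl n} (hx : x ≠ 0) {c : ℝ} (hc : 0 < c) :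
    c • fderiv ℝ (gradient (suppFun K)) (c • x) = fderiv ℝ (gradient (suppFun K)) x := by
  have h1 : HasFDerivAt (fun z : Eucl n => c • z) (c • ContinuousLinearMap.id ℝ (Eucl n)) x :=
    (hasFDerivAt_id x).const_smul c
  have h2 := (hK.differentiableAt_gradient (smul_ne_zero hc.ne' hx)).hasFDerivAt.comp x h1
  have h3 : gradient (suppFun K) ∘ (fun z : Eucl n => c • z) =ᶠ[𝓝 x] gradient (suppFun K) := by
    filter_upwards [isOpen_compl_singleton.mem_nhds hx] with z hz
    exact hK.gradient_smul hz hc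
  rw [(h2.congr_of_eventuallyEq h3.symm).fderiv]
  ext v
  simp

lemma isPositive_fderiv_gradient (hK : IsSmoothBody K) {x : Eucl n} (hx : x ≠ 0) :
    (fderiv ℝ (gradient (suppFun K)) x : Eucl n →ₗ[ℝ] Eucl n).IsPositive := by
  refine ⟨isSymmetric_fderiv_gradient (hK.contDiffAt_two hx), fun v => ?_⟩
  have hlin : ContDiff ℝ 2 fun z : Eucl n => ⟪gradient (suppFun K) x, z⟫ :=
    (innerSL ℝ _).contDiff
  have hmin : IsLocalMin (fun z => suppFun K z - ⟪gradient (suppFun K) x, z⟫) x := by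
    refine Filter.Eventually.of_forall fun z => ?_
    have h1 := inner_le_suppFun hK.isCompact z (hK.gradient_mem hx)
    have h2 := hK.inner_gradient hx
    rw [real_inner_comm] at h1 h2
    simp only [h2]
    linarith
  have h := fderiv_gradient_nonneg_of_isLocalMin ((hK.contDiffAt_two hx).sub hlin.contDiffAt)
    hmin v
  have h3 : gradient (fun z => suppFun K z - ⟪gradient (suppFun K) x, z⟫) =ᶠ[𝓝 x]
      fun z => gradient (suppFun K) z - gradient (suppFun K) x := by
    filter_upwards [isOpen_compl_singleton.mem_nhds hx] with z hz
    have hd := (hK.contDiffAt_two hz).differentiableAt two_ne_zero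
    have hl : HasFDerivAt (fun z : Eucl n => ⟪gradient (suppFun K) x, z⟫)
      (innerSL ℝ (gradient (suppFun K) x)) z := (innerSL ℝ _).hasFDerivAt
    have : fderiv ℝ (fun z => suppFun K z - ⟪gradient (suppFun K) x, z⟫) z =
      fderiv ℝ (suppFun K) z - innerSL ℝ (gradient (suppFun K) x) :=
        (hd.hasFDerivAt.sub hl).fderiv
    rw [gradient, this, map_sub]
    congr 1
    exact (InnerProductSpace.toDual ℝ (Eucl n)).symm_apply_apply _
  rw [h3.fderiv_eq, fderiv_sub_const] at h
  simpa using h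

end IsSmoothBody

lemma isPositive_rankOne (x : Eucl n) : (rankOne x).IsPositive := by
  refine ⟨fun v w => ?_, fun v => ?_⟩
  · simp only [rankOne, LinearMap.coe_mk, AddHom.coe_mk, inner_smul_left, inner_smul_right,
      real_inner_comm]
    simp only [conj_trivial]
    ring
  · simp only [rankOne, LinearMap.coe_mk, AddHom.coe_mk, inner_smul_left]
    simpa using mul_self_nonneg _

/-- If a support function lies above `x ↦ κ h_L(x) + ⟪p, x⟫` and touches it at `x`, then its
curvature determinant at `x` controls that of `L`. -/
lemma curvDet_ge_of_touching {K L : Set (Eucl n)} (hK : IsSmoothBody K) (hL : IsSmoothBody L)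
    {κ : ℝ} (hκ : 0 < κ) (hκ1 : κ ≤ 1) (p : Eucl n) {x : Eucl n}
    (hx : x ∈ Metric.sphere (0 : Eucl n) 1)
    (hle : ∀ z, κ * suppFun L z + ⟪p, z⟫ ≤ suppFun K z)
    (heq : κ * suppFun L x + ⟪p, x⟫ = suppFun K x) :
    κ ^ n * curvDet (suppFun L) x ≤ curvDet (suppFun K) x := by
  have hx0 : x ≠ 0 := by
    rintro rfl
    simp at hx
  have hlin : ContDiff ℝ 2 fun z : Eucl n => ⟪p, z⟫ := (innerSL ℝ p).contDiff
  set E : Eucl n → ℝ := fun z => suppFun K z - (κ * suppFun L z + ⟪p, z⟫) with hE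
  have hmin : IsLocalMin E x := by
    refine Filter.Eventually.of_forall fun z => ?_
    have := hle z
    simp only [hE]
    rw [heq]
    linarith
  have hsm : ContDiffAt ℝ 2 E x :=
    (hK.contDiffAt_two hx0).sub
      ((contDiffAt_const.mul (hL.contDiffAt_two hx0)).add hlin.contDiffAt)
  have h3 : gradient E =ᶠ[𝓝 x]
      fun z => gradient (suppFun K) z - (κ • gradient (suppFun L) z + p) := by
    filter_upwards [isOpen_compl_singleton.mem_nhds hx0] with z hz
    have hdK := (hK.contDiffAt_two hz).differentiableAt two_ne_zero
    have hdL := (hL.contDiffAt_two hz).differentiableAt two_ne_zero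
    have hl : HasFDerivAt (fun z : Eucl n => ⟪p, z⟫) (innerSL ℝ p) z := (innerSL ℝ _).hasFDerivAt
    have : fderiv ℝ E z = fderiv ℝ (suppFun K) z - (κ • fderiv ℝ (suppFun L) z + innerSL ℝ p) :=
      (hdK.hasFDerivAt.sub ((hdL.hasFDerivAt.const_mul κ).add hl)).fderiv
    rw [gradient, this, map_sub, map_add]
    congr 2
    · simp [gradient]
    · exact (InnerProductSpace.toDual ℝ (Eucl n)).symm_apply_apply _
  have hfd : fderiv ℝ (gradient E) x =
      fderiv ℝ (gradient (suppFun K)) x - κ • fderiv ℝ (gradient (suppFun L)) x := by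
    rw [h3.fderiv_eq]
    exact ((hK.differentiableAt_gradient hx0).hasFDerivAt.sub
      (((hL.differentiableAt_gradient hx0).hasFDerivAt.const_smul κ).add_const p)).fderiv
  set DK : Eucl n →ₗ[ℝ] Eucl n := (fderiv ℝ (gradient (suppFun K)) x).toLinearMap with hDK
  set DL : Eucl n →ₗ[ℝ] Eucl n := (fderiv ℝ (gradient (suppFun L)) x).toLinearMap with hDL
  have hC : (DK - κ • DL).IsPositive := by
    have h4 : DK - κ • DL = (fderiv ℝ (gradient E) x : Eucl n →ₗ[ℝ] Eucl n) := by
      rw [hfd]; ext; simp [hDK, hDL]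
    rw [h4]
    exact ⟨isSymmetric_fderiv_gradient hsm, fun v =>
      fderiv_gradient_nonneg_of_isLocalMin hsm hmin v⟩
  have hA : (DL + rankOne x).IsPositive :=
    (hL.isPositive_fderiv_gradient hx0).add (isPositive_rankOne x)
  have hdetA : LinearMap.det (κ • (DL + rankOne x)) = κ ^ n * curvDet (suppFun L) x := by
    rw [LinearMap.det_smul]; simp [curvDet, hDL]
  have hsum : DK + rankOne x =
      κ • (DL + rankOne x) + ((DK - κ • DL) + (1 - κ) • rankOne x) := by
    module
  have hle := (hA.smul_of_nonneg (c := κ) hκ.le).det_le_det_add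
    (by rw [hdetA]; have := hL.curvDet_pos hx; positivity)
    (hC.add ((isPositive_rankOne x).smul_of_nonneg (c := 1 - κ) (by linarith)))
  rw [hdetA, ← hsum] at hle
  exact hle

end SmoothBody

section GaussianRieszPotential

variable {n : ℕ}

lemma integrable_indicator_rpow_norm (hn : 1 ≤ n) {α : ℝ} (hα : α < n) (R : ℝ) :
    Integrable (fun u : Eucl n =>
      (Metric.closedBall (0 : Eucl n) R).indicator (fun u => (‖u‖ ^ α)⁻¹) u) := by
  have : NeZero n := ⟨by omega⟩
  have h1 : (fun u : Eucl n =>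
      (Metric.closedBall (0 : Eucl n) R).indicator (fun u => (‖u‖ ^ α)⁻¹) u) =
      fun u : Eucl n => (Set.Iic R).indicator (fun s : ℝ => (s ^ α)⁻¹) ‖u‖ := by
    ext u
    simp [Set.indicator]
  rw [h1]
  refine (integrable_fun_norm_addHaar volume).2 ?_
  have hI : IntegrableOn (fun s : ℝ => s ^ ((n : ℝ) - 1 - α)) (Set.Ioc 0 (max R 0)) := by
    have := (intervalIntegral.intervalIntegrable_rpow' (a := 0) (b := max R 0)
      (r := (n : ℝ) - 1 - α) (by linarith)).1
    simpa using this
  have hI2 : IntegrableOn (fun s : ℝ => (Set.Ioc 0 (max R 0)).indicator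
      (fun s : ℝ => s ^ ((n : ℝ) - 1 - α)) s) (Set.Ioi 0) :=
    ((integrable_indicator_iff measurableSet_Ioc).2 hI).integrableOn
  refine hI2.congr_fun (fun s hs => ?_) measurableSet_Ioi
  have hs : 0 < s := hs
  simp only [finrank_euclideanSpace, Fintype.card_fin, smul_eq_mul, Set.indicator, Set.mem_Ioc,
    Set.mem_Iic, hs, true_and, le_max_iff, not_le.2 hs, or_false]
  split_ifs
  · rw [← Real.rpow_neg hs.le, ← Real.rpow_natCast, ← Real.rpow_add hs]
    push_cast [hn]
    congr 1
  · simp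

variable {K : Set (Eucl n)}

lemma riesz_integrand_shift (α : ℝ) (y : Eucl n) :
    (fun u => K.indicator (fun z => Real.exp (-‖z‖ ^ 2 / 2) / ‖z - y‖ ^ α) (u + y)) =
    fun u => K.indicator (fun z => Real.exp (-‖z‖ ^ 2 / 2)) (u + y) * (‖u‖ ^ α)⁻¹ := by
  ext u
  by_cases h : u + y ∈ K
  · simp [h, div_eq_mul_inv]
  · simp [h]

lemma norm_riesz_integrand_le (α : ℝ) {R : ℝ} (hR : K ⊆ Metric.closedBall 0 R) {R' : ℝ}
    {y : Eucl n} (hy : ‖y‖ ≤ R') (u : Eucl n) :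
    ‖K.indicator (fun z => Real.exp (-‖z‖ ^ 2 / 2)) (u + y) * (‖u‖ ^ α)⁻¹‖ ≤
      (Metric.closedBall (0 : Eucl n) (R + R')).indicator (fun u => (‖u‖ ^ α)⁻¹) u := by
  by_cases h : u + y ∈ K
  · have h1 : ‖u + y‖ ≤ R := by simpa using hR h
    have h2 : u ∈ Metric.closedBall (0 : Eucl n) (R + R') := by
      rw [mem_closedBall_zero_iff]
      calc ‖u‖ = ‖(u + y) - y‖ := by simp
        _ ≤ ‖u + y‖ + ‖y‖ := norm_sub_le _ _
        _ ≤ _ := by linarith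
    rw [Set.indicator_of_mem h, Set.indicator_of_mem h2, norm_mul, norm_inv,
      Real.norm_of_nonneg (Real.exp_nonneg _), Real.norm_of_nonneg (by positivity)]
    refine mul_le_of_le_one_left (by positivity) (Real.exp_le_one_iff.2 ?_)
    have := sq_nonneg ‖u + y‖
    linarith
  · rw [Set.indicator_of_notMem h, zero_mul, norm_zero]
    exact Set.indicator_nonneg (fun _ _ => by positivity) _

lemma aestronglyMeasurable_riesz_integrand (hK : IsCompact K) (α : ℝ) (y : Eucl n) :
    AEStronglyMeasurable
      (fun u => K.indicator (fun z => Real.exp (-‖z‖ ^ 2 / 2)) (u + y) * (‖u‖ ^ α)⁻¹)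
      (volume : Measure (Eucl n)) := by
  have h1 : Measurable (K.indicator (fun z : Eucl n => Real.exp (-‖z‖ ^ 2 / 2))) :=
    Measurable.indicator (by fun_prop) hK.measurableSet
  have h2 : Measurable fun u : Eucl n => (‖u‖ ^ α)⁻¹ := (measurable_norm.pow_const α).inv
  exact ((h1.comp (measurable_id.add_const y)).mul h2).aestronglyMeasurable

lemma integrable_riesz_shift (hn : 1 ≤ n) (hK : IsCompact K) {α : ℝ} (hα : α < n) (y : Eucl n) :
    Integrable
      (fun u => K.indicator (fun z => Real.exp (-‖z‖ ^ 2 / 2)) (u + y) * (‖u‖ ^ α)⁻¹) := by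
  obtain ⟨R, hR⟩ := hK.isBounded.subset_closedBall 0
  exact (integrable_indicator_rpow_norm hn hα (R + ‖y‖)).mono'
    (aestronglyMeasurable_riesz_integrand hK α y)
    (Filter.Eventually.of_forall fun u => norm_riesz_integrand_le α hR le_rfl u)

lemma integrableOn_riesz (hn : 1 ≤ n) (hK : IsCompact K) {α : ℝ} (hα : α < n) (y : Eucl n) :
    IntegrableOn (fun z => Real.exp (-‖z‖ ^ 2 / 2) / ‖z - y‖ ^ α) K := by
  rw [← integrable_indicator_iff hK.measurableSet]
  have h := integrable_riesz_shift hn hK hα y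
  rw [← riesz_integrand_shift α y] at h
  simpa using h.comp_add_right (-y)

lemma setIntegral_riesz_eq (hK : IsCompact K) (α : ℝ) (y : Eucl n) :
    ∫ z in K, Real.exp (-‖z‖ ^ 2 / 2) / ‖z - y‖ ^ α =
    ∫ u, K.indicator (fun z => Real.exp (-‖z‖ ^ 2 / 2)) (u + y) * (‖u‖ ^ α)⁻¹ := by
  rw [← integral_indicator hK.measurableSet, ← riesz_integrand_shift α y,
    integral_add_right_eq_self (μ := volume)
      (K.indicator (fun z => Real.exp (-‖z‖ ^ 2 / 2) / ‖z - y‖ ^ α)) y]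

lemma Vtilde_nonneg (q : ℝ) (K : Set (Eucl n)) (y : Eucl n) : 0 ≤ Vtilde q K y :=
  mul_nonneg (by positivity) (integral_nonneg fun z => by positivity)

lemma exists_Vtilde_le (hn : 1 ≤ n) {q : ℝ} (hq : 1 < q) (R : ℝ) :
    ∃ C : ℝ, 0 ≤ C ∧ ∀ K : Set (Eucl n), IsCompact K → K ⊆ Metric.closedBall 0 R →
      ∀ y ∈ Metric.closedBall (0 : Eucl n) R, Vtilde q K y ≤ C := by
  have hα : (n : ℝ) - q + 1 < n := by linarith
  refine ⟨2 * ∫ u : Eucl n, (Metric.closedBall (0 : Eucl n) (R + R)).indicator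
    (fun u => (‖u‖ ^ ((n : ℝ) - q + 1))⁻¹) u, ?_, fun K hK hKR y hy => ?_⟩
  · exact mul_nonneg zero_le_two
      (integral_nonneg fun u => Set.indicator_nonneg (fun _ _ => by positivity) _)
  · rw [Vtilde, setIntegral_riesz_eq hK]
    have h1 : Real.exp (-‖y‖ ^ 2 / 2) ≤ 1 :=
      Real.exp_le_one_iff.2 (by have := sq_nonneg ‖y‖; linarith)
    refine mul_le_mul (by linarith) ?_ (integral_nonneg fun u => mul_nonneg
      (Set.indicator_nonneg (fun _ _ => by positivity) _) (by positivity)) zero_le_two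
    refine integral_mono (integrable_riesz_shift hn hK hα y)
      (integrable_indicator_rpow_norm hn hα _) fun u => ?_
    exact (le_abs_self _).trans (norm_riesz_integrand_le _ hKR (by simpa using hy) u)

lemma exists_le_Vtilde (hn : 1 ≤ n) {q : ℝ} (hq : 1 < q) {r R : ℝ} (hr : 0 < r) :
    ∃ c : ℝ, 0 < c ∧ ∀ K : Set (Eucl n), IsCompact K → K ⊆ Metric.closedBall 0 R →
      Metric.closedBall 0 r ⊆ K →
      ∀ y : Eucl n, r ≤ ‖y‖ → ‖y‖ ≤ R → c ≤ Vtilde q K y := by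
  rcases lt_or_ge R r with hRr | hRr
  · exact ⟨1, one_pos, fun K _ _ _ y h1 h2 => by linarith⟩
  have hR0 : 0 < R := hr.trans_le hRr
  set α := (n : ℝ) - q + 1 with hαdef
  have hα : α < n := by linarith
  set B := (2 * R) ^ α + (r / 2) ^ α with hB
  have hB0 : 0 < B := by positivity
  set m := volume.real (Metric.closedBall (0 : Eucl n) (r / 2)) with hm
  have hm0 : 0 < m := by
    refine ENNReal.toReal_pos (Metric.measure_closedBall_pos _ _ (by positivity)).ne' ?_
    exact (isCompact_closedBall _ _).measure_lt_top.ne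
  set e := Real.exp (-R ^ 2 / 2) with he
  have hexp : ∀ z : Eucl n, ‖z‖ ≤ R → e ≤ Real.exp (-‖z‖ ^ 2 / 2) := fun z hz => by
    refine Real.exp_le_exp.2 ?_
    have : ‖z‖ ^ 2 ≤ R ^ 2 := by gcongr
    linarith
  have he0 : 0 < e := Real.exp_pos _
  refine ⟨2 * e * (e / B * m), by positivity, fun K hK hKR hrK y h1 h2 => ?_⟩
  rw [Vtilde]
  have hsub : Metric.closedBall (0 : Eucl n) (r / 2) ⊆ K :=
    (Metric.closedBall_subset_closedBall (by linarith)).trans hrK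
  have hgint := integrableOn_riesz hn hK hα y
  refine mul_le_mul (by linarith [hexp y h2]) ?_ (by positivity) (by positivity)
  calc e / B * m ≤ ∫ z in Metric.closedBall (0 : Eucl n) (r / 2),
        Real.exp (-‖z‖ ^ 2 / 2) / ‖z - y‖ ^ α := by
        refine setIntegral_ge_of_const_le_real measurableSet_closedBall
          (isCompact_closedBall _ _).measure_lt_top.ne (fun z hz => ?_) (hgint.mono_set hsub)
        have hz' : ‖z‖ ≤ r / 2 := by simpa using hz
        have h3 : ‖z - y‖ ≤ 2 * R := (norm_sub_le _ _).trans (by linarith)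
        have h4 : r / 2 ≤ ‖z - y‖ := by
          have := norm_sub_norm_le y z
          rw [norm_sub_rev] at this
          linarith
        have h5 : 0 < ‖z - y‖ := by linarith
        have h6 : ‖z - y‖ ^ α ≤ B := by
          rcases le_total 0 α with h | h
          · have := Real.rpow_le_rpow h5.le h3 h
            have : 0 < (r / 2) ^ α := by positivity
            linarith
          · have := Real.rpow_le_rpow_of_nonpos (by positivity) h4 h
            have : 0 < (2 * R) ^ α := by positivity
            linarith
        exact div_le_div₀ (Real.exp_nonneg _) (hexp z (by linarith)) (by positivity) h6
    _ ≤ ∫ z in K, Real.exp (-‖z‖ ^ 2 / 2) / ‖z - y‖ ^ α :=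
        setIntegral_mono_set hgint (Filter.Eventually.of_forall fun z => by positivity)
          (Filter.Eventually.of_forall hsub)

lemma continuous_Vtilde (hn : 1 ≤ n) {q : ℝ} (hq : 1 < q) (hK : IsCompact K)
    (hconv : Convex ℝ K) : Continuous (Vtilde q K) := by
  have hα : (n : ℝ) - q + 1 < n := by linarith
  obtain ⟨R, hR⟩ := hK.isBounded.subset_closedBall 0
  refine Continuous.mul (by fun_prop) ?_
  simp_rw [setIntegral_riesz_eq hK]
  refine continuous_iff_continuousAt.2 fun y => ?_
  refine continuousAt_of_dominated
    (Filter.Eventually.of_forall fun z => aestronglyMeasurable_riesz_integrand hK _ z)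
    (bound := (Metric.closedBall (0 : Eucl n) (R + (‖y‖ + 1))).indicator
      (fun u => (‖u‖ ^ ((n : ℝ) - q + 1))⁻¹)) ?_
    (integrable_indicator_rpow_norm hn hα _) ?_
  · filter_upwards [Metric.closedBall_mem_nhds y one_pos] with z hz
    refine Filter.Eventually.of_forall fun u => norm_riesz_integrand_le _ hR ?_ u
    have := norm_le_norm_add_norm_sub y z
    rw [Metric.mem_closedBall, dist_eq_norm, norm_sub_rev] at hz
    linarith
  · have hae : ∀ᵐ u : Eucl n, u + y ∉ frontier K := by
      have h0 : ∀ᵐ z : Eucl n, z ∉ frontier K := by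
        rw [ae_iff]
        simpa using hconv.addHaar_frontier volume
      exact (quasiMeasurePreserving_add_right volume y).ae h0
    filter_upwards [hae] with u hu
    refine ContinuousAt.mul ?_ continuousAt_const
    have h1 : ContinuousAt (K.indicator (fun z : Eucl n => Real.exp (-‖z‖ ^ 2 / 2))) (u + y) :=
      (show Continuous fun z : Eucl n => Real.exp (-‖z‖ ^ 2 / 2) by
        fun_prop).continuousOn.continuousAt_indicator hu
    exact ContinuousAt.comp (f := fun z => u + z) h1 (by fun_prop)

end GaussianRieszPotential

section SphereMeasure

variable {n : ℕ}

/-- Normalized cone measure on the unit sphere: the image of Lebesgue measure on the unit ball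
under radial projection. -/
def coneMeasure (n : ℕ) : Measure (Eucl n) :=
  (volume.restrict (Metric.ball (0 : Eucl n) 1)).map (fun x => ‖x‖⁻¹ • x)

lemma measurable_normalize : Measurable (fun x : Eucl n => ‖x‖⁻¹ • x) :=
  measurable_norm.inv.smul measurable_id

lemma finrank_orthogonal_eq {v : Eucl n} (hv : ‖v‖ = 1) :
    (Module.finrank ℝ ((ℝ ∙ v)ᗮ : Submodule ℝ (Eucl n)) : ℝ) = (n : ℝ) - 1 := by
  have hv0 : v ≠ 0 := by
    rintro rfl
    simp at hv
  have h1 := (ℝ ∙ v).finrank_add_finrank_orthogonal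
  rw [finrank_span_singleton hv0, finrank_euclideanSpace, Fintype.card_fin] at h1
  have h2 := congrArg (fun k : ℕ => (k : ℝ)) h1
  push_cast at h2
  linarith

lemma lipschitzOnWith_normalize :
    LipschitzOnWith 2 (fun x : Eucl n => ‖x‖⁻¹ • x) {x | 1 ≤ ‖x‖} := by
  refine lipschitzOnWith_iff_norm_sub_le.2 fun x hx y hy => ?_
  have hx : 1 ≤ ‖x‖ := hx
  have hy : 1 ≤ ‖y‖ := hy
  have hx0 : 0 < ‖x‖ := by linarith
  have hy0 : 0 < ‖y‖ := by linarith
  have h1 : ‖x‖⁻¹ • x - ‖y‖⁻¹ • y = ‖x‖⁻¹ • (x - y) + (‖x‖⁻¹ - ‖y‖⁻¹) • y := by module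
  have h2 : ‖(‖x‖⁻¹ - ‖y‖⁻¹) • y‖ ≤ ‖x - y‖ := by
    have h3 : ‖x‖⁻¹ - ‖y‖⁻¹ = ‖x‖⁻¹ * ‖y‖⁻¹ * (‖y‖ - ‖x‖) := by field_simp
    rw [norm_smul, h3, norm_mul, Real.norm_of_nonneg (by positivity : 0 ≤ ‖x‖⁻¹ * ‖y‖⁻¹),
      Real.norm_eq_abs]
    have h4 : |‖y‖ - ‖x‖| ≤ ‖x - y‖ := by
      rw [norm_sub_rev]
      exact abs_norm_sub_norm_le y x
    calc ‖x‖⁻¹ * ‖y‖⁻¹ * |‖y‖ - ‖x‖| * ‖y‖ = ‖x‖⁻¹ * |‖y‖ - ‖x‖| := by field_simp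
      _ ≤ 1 * |‖y‖ - ‖x‖| := by gcongr; exact inv_le_one_of_one_le₀ hx
      _ ≤ _ := by rwa [one_mul]
  have h5 : ‖‖x‖⁻¹ • (x - y)‖ ≤ ‖x - y‖ := by
    rw [norm_smul, norm_inv, norm_norm]
    exact mul_le_of_le_one_left (norm_nonneg _) (inv_le_one_of_one_le₀ hx)
  simp only [h1, NNReal.coe_ofNat]
  linarith [norm_add_le (‖x‖⁻¹ • (x - y)) ((‖x‖⁻¹ - ‖y‖⁻¹) • y)]

lemma norm_add_sq_of_mem_orthogonal {v : Eucl n} (hv : ‖v‖ = 1) (w : (ℝ ∙ v)ᗮ) :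
    ‖v + w‖ ^ 2 = 1 + ‖w‖ ^ 2 := by
  have h0 : ⟪v, (w : Eucl n)⟫ = 0 := Submodule.mem_orthogonal_singleton_iff_inner_right.1 w.2
  rw [norm_add_sq_real, h0, hv]
  simp

lemma hausdorffMeasure_sphere_lt_top (hn : 1 ≤ n) :
    μH[(n : ℝ) - 1] (Metric.sphere (0 : Eucl n) 1) < ⊤ := by
  have hn' : (0 : ℝ) ≤ (n : ℝ) - 1 := by
    have : (1 : ℝ) ≤ n := by exact_mod_cast hn
    linarith
  refine (isCompact_sphere (0 : Eucl n) 1).measure_lt_top_of_nhdsWithin fun v hv => ?_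
  have hv1 : ‖v‖ = 1 := by simpa using hv
  refine ⟨{x | 1 / 2 < ⟪v, x⟫} ∩ Metric.sphere (0 : Eucl n) 1,
    Filter.inter_mem (mem_nhdsWithin_of_mem_nhds ?_) self_mem_nhdsWithin, ?_⟩
  · refine (isOpen_lt continuous_const (by fun_prop)).mem_nhds ?_
    rw [Set.mem_ofPred_eq, real_inner_self_eq_norm_sq, hv1]
    norm_num
  · set g : (ℝ ∙ v)ᗮ → Eucl n := fun w => ‖v + w‖⁻¹ • (v + w) with hg
    have hLip : LipschitzOnWith 2 g Set.univ := by
      have h1 : LipschitzOnWith 1 (fun w : (ℝ ∙ v)ᗮ => v + (w : Eucl n)) Set.univ :=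
        (LipschitzWith.of_dist_le_mul fun a b => by
          simp [dist_add_left, Subtype.dist_eq]).lipschitzOnWith
      have h2 := lipschitzOnWith_normalize.comp h1 (fun w _ => ?_)
      · rw [mul_one] at h2
        exact h2
      · have h3 := norm_add_sq_of_mem_orthogonal hv1 w
        have h4 : (1 : ℝ) ≤ ‖v + w‖ ^ 2 := by
          rw [h3]
          nlinarith [sq_nonneg ‖w‖]
        exact (one_le_sq_iff₀ (norm_nonneg _)).1 h4
    have hsub : {x | 1 / 2 < ⟪v, x⟫} ∩ Metric.sphere (0 : Eucl n) 1 ⊆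
        g '' Metric.closedBall 0 3 := by
      rintro x ⟨hx1, hx2⟩
      have hx1 : 1 / 2 < ⟪v, x⟫ := hx1
      have hx2 : ‖x‖ = 1 := by simpa using hx2
      have hpos : 0 < ⟪v, x⟫ := by linarith
      have hinv : ⟪v, x⟫⁻¹ ≤ 2 := by
        rw [inv_le_comm₀ hpos two_pos]
        linarith
      have hmem : ⟪v, x⟫⁻¹ • x - v ∈ (ℝ ∙ v)ᗮ := by
        rw [Submodule.mem_orthogonal_singleton_iff_inner_right, inner_sub_right,
          inner_smul_right, real_inner_self_eq_norm_sq, hv1]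
        field_simp
        norm_num
      refine ⟨⟨_, hmem⟩, ?_, ?_⟩
      · rw [mem_closedBall_zero_iff, Submodule.coe_norm]
        refine (norm_sub_le _ _).trans ?_
        rw [norm_smul, hx2, hv1, Real.norm_of_nonneg (by positivity)]
        linarith
      · simp only [hg, add_sub_cancel, norm_smul, hx2, norm_inv, mul_one, inv_inv, smul_smul,
          Real.norm_of_nonneg hpos.le]
        rw [mul_inv_cancel₀ hpos.ne', one_smul]
    have hfin : μH[(n : ℝ) - 1] (Metric.closedBall (0 : (ℝ ∙ v)ᗮ) 3) < ⊤ := by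
      rw [← finrank_orthogonal_eq hv1]
      have := isAddHaarMeasure_hausdorffMeasure (E := ((ℝ ∙ v)ᗮ : Submodule ℝ (Eucl n)))
      exact (isCompact_closedBall _ _).measure_lt_top
    refine (measure_mono hsub).trans_lt
      (((hLip.mono (Set.subset_univ _)).hausdorffMeasure_image_le hn').trans_lt ?_)
    exact ENNReal.mul_lt_top (ENNReal.rpow_lt_top_of_nonneg hn' (by simp)) hfin

lemma hausdorffMeasure_sphere_ne_zero (hn : 1 ≤ n) :
    μH[(n : ℝ) - 1] (Metric.sphere (0 : Eucl n) 1) ≠ 0 := by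
  have hn' : (0 : ℝ) ≤ (n : ℝ) - 1 := by
    have : (1 : ℝ) ≤ n := by exact_mod_cast hn
    linarith
  have : Nonempty (Fin n) := ⟨⟨0, hn⟩⟩
  obtain ⟨v, hv⟩ := exists_norm_eq (Eucl n) zero_le_one
  refine fun h0 => ?_
  have hle := hausdorffMeasure_orthogonalProjectionOnto_le ((ℝ ∙ v)ᗮ : Submodule ℝ (Eucl n))
    ((n : ℝ) - 1) (Metric.sphere (0 : Eucl n) 1) hn'
  rw [h0] at hle
  have hsub : Metric.ball (0 : (ℝ ∙ v)ᗮ) 1 ⊆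
      ((ℝ ∙ v)ᗮ : Submodule ℝ (Eucl n)).orthogonalProjectionOnto '' Metric.sphere 0 1 := by
    intro w hw
    have hw : ‖w‖ < 1 := by simpa using hw
    have hsq : 0 ≤ 1 - ‖w‖ ^ 2 := by nlinarith [norm_nonneg w]
    have hinner : ⟪v, (w : Eucl n)⟫ = 0 :=
      Submodule.mem_orthogonal_singleton_iff_inner_right.1 w.2
    refine ⟨√(1 - ‖w‖ ^ 2) • v + w, ?_, ?_⟩
    · rw [mem_sphere_zero_iff_norm, ← sq_eq_sq₀ (norm_nonneg _) zero_le_one, norm_add_sq_real,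
        inner_smul_left, hinner, norm_smul, hv, mul_one, Real.norm_of_nonneg (Real.sqrt_nonneg _),
        Real.sq_sqrt hsq, ← Submodule.coe_norm]
      ring
    · rw [map_add, map_smul]
      have h1 : ((ℝ ∙ v)ᗮ : Submodule ℝ (Eucl n)).orthogonalProjectionOnto v = 0 := by
        exact Submodule.orthogonalProjectionOnto_orthogonalComplement_singleton_eq_zero v
      rw [h1]
      simp
  have hpos : 0 < μH[(n : ℝ) - 1] (Metric.ball (0 : (ℝ ∙ v)ᗮ) 1) := by
    rw [← finrank_orthogonal_eq hv]
    have := isAddHaarMeasure_hausdorffMeasure (E := ((ℝ ∙ v)ᗮ : Submodule ℝ (Eucl n)))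
    exact Metric.measure_ball_pos _ _ one_pos
  exact absurd ((hpos.trans_le (measure_mono hsub)).trans_le hle) (lt_irrefl _)

lemma measure_closedBall_eq_of_map_eq {μ : Measure (Eucl n)}
    (hμ : ∀ φ : Eucl n ≃ₗᵢ[ℝ] Eucl n, μ.map φ = μ) {x y : Eucl n} (hxy : ‖x‖ = ‖y‖) (r : ℝ) :
    μ (Metric.closedBall x r) = μ (Metric.closedBall y r) := by
  set φ := ((ℝ ∙ (x - y))ᗮ : Submodule ℝ (Eucl n)).reflection with hφ
  have h1 : φ x = y := Submodule.reflection_sub hxy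
  have h2 : φ ⁻¹' Metric.closedBall y r = Metric.closedBall x r := by
    rw [← h1]
    exact φ.isometry.preimage_closedBall x r
  rw [← h2, ← Measure.map_apply φ.continuous.measurable measurableSet_closedBall, hμ φ]

lemma map_hausdorffMeasure_sphere (d : ℝ) (φ : Eucl n ≃ₗᵢ[ℝ] Eucl n) :
    (μH[d].restrict (Metric.sphere (0 : Eucl n) 1)).map φ =
      μH[d].restrict (Metric.sphere (0 : Eucl n) 1) := by
  have h1 : φ ⁻¹' Metric.sphere (0 : Eucl n) 1 = Metric.sphere 0 1 := by
    ext x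
    simp
  rw [← h1, ← Measure.restrict_map φ.continuous.measurable Metric.isClosed_sphere.measurableSet,
    h1]
  congr 1
  exact φ.toIsometryEquiv.map_hausdorffMeasure d

lemma map_coneMeasure (φ : Eucl n ≃ₗᵢ[ℝ] Eucl n) :
    (coneMeasure n).map φ = coneMeasure n := by
  have h1 : φ ⁻¹' Metric.ball (0 : Eucl n) 1 = Metric.ball 0 1 := by
    ext x
    simp
  have h2 : (volume.restrict (Metric.ball (0 : Eucl n) 1)).map φ =
      volume.restrict (Metric.ball (0 : Eucl n) 1) := by
    rw [← h1, ← Measure.restrict_map φ.continuous.measurable measurableSet_ball, h1,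
      φ.measurePreserving.map_eq]
  rw [coneMeasure, Measure.map_map φ.continuous.measurable measurable_normalize]
  conv_rhs => rw [← h2]
  rw [Measure.map_map measurable_normalize φ.continuous.measurable]
  congr 1
  ext1 x
  simp

instance isFiniteMeasure_coneMeasure : IsFiniteMeasure (coneMeasure n) := by
  have : IsFiniteMeasure (volume.restrict (Metric.ball (0 : Eucl n) 1)) :=
    ⟨by simpa using measure_ball_lt_top⟩
  rw [coneMeasure]
  infer_instance

lemma coneMeasure_ae_norm_eq (hn : 1 ≤ n) : ∀ᵐ x ∂coneMeasure n, ‖x‖ = 1 := by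
  have : Nonempty (Fin n) := ⟨⟨0, hn⟩⟩
  rw [coneMeasure, ae_map_iff measurable_normalize.aemeasurable
    (measurableSet_eq_fun measurable_norm measurable_const)]
  refine ae_restrict_of_ae ?_
  filter_upwards [Measure.ae_ne volume (0 : Eucl n)] with x hx
  rw [norm_smul, norm_inv, norm_norm, inv_mul_cancel₀ (norm_ne_zero_iff.2 hx)]

lemma coneMeasure_ne_zero : coneMeasure n ≠ 0 := by
  intro h
  have h1 := congrArg (fun μ : Measure (Eucl n) => μ Set.univ) h
  simp only [coneMeasure, Measure.map_apply measurable_normalize MeasurableSet.univ,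
    Set.preimage_univ, Measure.restrict_apply_univ, Measure.coe_zero, Pi.zero_apply] at h1
  exact (Metric.measure_ball_pos volume (0 : Eucl n) one_pos).ne' h1

lemma exists_eq_smul_of_map_eq {μ ν : Measure (Eucl n)} [IsFiniteMeasure μ] [IsFiniteMeasure ν]
    (hνμ : ν ≪ μ) (hμ0 : μ ≠ 0) (hsupp : ∀ᵐ x ∂μ, ‖x‖ = 1)
    (hμ : ∀ φ : Eucl n ≃ₗᵢ[ℝ] Eucl n, μ.map φ = μ)
    (hν : ∀ φ : Eucl n ≃ₗᵢ[ℝ] Eucl n, ν.map φ = ν) : ∃ c : ENNReal, ν = c • μ := by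
  have : (ae μ).NeBot := ae_neBot.2 hμ0
  have hae := (Besicovitch.ae_tendsto_rnDeriv ν μ).and hsupp
  obtain ⟨x, hx, hx1⟩ := hae.exists
  refine ⟨ν.rnDeriv μ x, ?_⟩
  have := Measure.haveLebesgueDecomposition_of_sigmaFinite ν μ
  have hd := Measure.withDensity_rnDeriv_eq ν μ hνμ
  rw [← withDensity_const]
  refine hd.symm.trans (withDensity_congr_ae ?_)
  filter_upwards [hae] with y hy
  refine tendsto_nhds_unique hy.1 (hx.congr fun r => ?_)
  rw [measure_closedBall_eq_of_map_eq hμ (hx1.trans hy.2.symm),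
    measure_closedBall_eq_of_map_eq hν (hx1.trans hy.2.symm)]

lemma isFiniteMeasure_hausdorffMeasure_sphere (hn : 1 ≤ n) :
    IsFiniteMeasure (μH[(n : ℝ) - 1].restrict (Metric.sphere (0 : Eucl n) 1)) :=
  ⟨by simpa using hausdorffMeasure_sphere_lt_top hn⟩

lemma exists_hausdorffMeasure_sphere_eq (hn : 1 ≤ n) :
    ∃ c : ENNReal, c ≠ ⊤ ∧
      μH[(n : ℝ) - 1].restrict (Metric.sphere (0 : Eucl n) 1) = c • coneMeasure n := by
  have := isFiniteMeasure_hausdorffMeasure_sphere hn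
  set σ := μH[(n : ℝ) - 1].restrict (Metric.sphere (0 : Eucl n) 1) with hσ
  have hσ0 : σ ≠ 0 := by
    rw [hσ, Ne, Measure.restrict_eq_zero]
    exact hausdorffMeasure_sphere_ne_zero hn
  have hsupp : ∀ᵐ x ∂(σ + coneMeasure n), ‖x‖ = 1 := by
    rw [ae_add_measure_iff]
    refine ⟨?_, coneMeasure_ae_norm_eq hn⟩
    filter_upwards [ae_restrict_mem Metric.isClosed_sphere.measurableSet] with x hx
    simpa using hx
  have hmap : ∀ φ : Eucl n ≃ₗᵢ[ℝ] Eucl n,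
      (σ + coneMeasure n).map φ = σ + coneMeasure n := fun φ => by
    rw [Measure.map_add _ _ φ.continuous.measurable, map_hausdorffMeasure_sphere,
      map_coneMeasure]
  have h0 : σ + coneMeasure n ≠ 0 := fun h => hσ0 (by
    refine le_antisymm ?_ (Measure.zero_le _)
    rw [← h]
    exact Measure.le_add_right le_rfl)
  obtain ⟨a, ha⟩ := exists_eq_smul_of_map_eq
    (Measure.le_add_right le_rfl : σ ≤ σ + coneMeasure n).absolutelyContinuous
    h0 hsupp hmap (map_hausdorffMeasure_sphere _)
  obtain ⟨b, hb⟩ := exists_eq_smul_of_map_eq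
    (Measure.le_add_left le_rfl : coneMeasure n ≤ σ + coneMeasure n).absolutelyContinuous
    h0 hsupp hmap map_coneMeasure
  have huniv : (σ + coneMeasure n) Set.univ ≠ 0 :=
    Measure.measure_univ_ne_zero.2 h0
  have htop : (σ + coneMeasure n) Set.univ ≠ ⊤ := measure_ne_top _ _
  have ha_top : a ≠ ⊤ := by
    rintro rfl
    have h1 := congrArg (fun μ : Measure (Eucl n) => μ Set.univ) ha
    simp only [Measure.smul_apply, smul_eq_mul] at h1
    rw [ENNReal.top_mul huniv] at h1
    exact measure_ne_top _ _ h1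
  have hb0 : b ≠ 0 := by
    rintro rfl
    exact coneMeasure_ne_zero (by simpa using hb)
  have hb_top : b ≠ ⊤ := by
    rintro rfl
    have h1 := congrArg (fun μ : Measure (Eucl n) => μ Set.univ) hb
    simp only [Measure.smul_apply, smul_eq_mul] at h1
    rw [ENNReal.top_mul huniv] at h1
    exact measure_ne_top _ _ h1
  refine ⟨a * b⁻¹, ENNReal.mul_ne_top ha_top (ENNReal.inv_ne_top.2 hb0), ?_⟩
  conv_lhs => rw [ha]
  conv_rhs => rw [hb]
  rw [smul_smul, mul_assoc, ENNReal.inv_mul_cancel hb0 hb_top, mul_one]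

/-- Integrals over the unit sphere are, up to one universal constant, integrals over the unit ball
of `0`-homogeneous functions. -/
lemma exists_setIntegral_sphere_eq (hn : 1 ≤ n) :
    ∃ c : ℝ, ∀ F : Eucl n → ℝ, Measurable F →
      ∫ x in Metric.sphere (0 : Eucl n) 1, F x ∂μH[(n : ℝ) - 1] =
        c * ∫ x in Metric.ball (0 : Eucl n) 1, F (‖x‖⁻¹ • x) := by
  obtain ⟨c, -, hc⟩ := exists_hausdorffMeasure_sphere_eq hn
  refine ⟨c.toReal, fun F hF => ?_⟩
  rw [hc, integral_smul_measure, coneMeasure,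
    integral_map measurable_normalize.aemeasurable hF.aestronglyMeasurable, smul_eq_mul]

lemma measure_sphere_inter_pos (hn : 1 ≤ n) {U : Set (Eucl n)} (hU : IsOpen U) {x : Eucl n}
    (hx : x ∈ U) (hx1 : ‖x‖ = 1) :
    μH[(n : ℝ) - 1].restrict (Metric.sphere (0 : Eucl n) 1) U ≠ 0 := by
  set σ := μH[(n : ℝ) - 1].restrict (Metric.sphere (0 : Eucl n) 1) with hσ
  intro h0
  obtain ⟨r, hr, hrU⟩ := Metric.nhds_basis_closedBall.mem_iff.1 (hU.mem_nhds hx)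
  have h1 : σ (Metric.closedBall x r) = 0 := measure_mono_null hrU h0
  have h2 : σ (Metric.sphere (0 : Eucl n) 1) = 0 := by
    refine (isCompact_sphere (0 : Eucl n) 1).measure_zero_of_nhdsWithin fun y hy => ?_
    refine ⟨Metric.closedBall y r, mem_nhdsWithin_of_mem_nhds (Metric.closedBall_mem_nhds y hr), ?_⟩
    rw [← measure_closedBall_eq_of_map_eq (map_hausdorffMeasure_sphere ((n : ℝ) - 1))
      (hx1.trans (by simpa using hy.symm : (1 : ℝ) = ‖y‖))]
    exact h1
  rw [hσ, Measure.restrict_apply_self] at h2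
  exact hausdorffMeasure_sphere_ne_zero hn h2

end SphereMeasure

section RadialMap

variable {n : ℕ} {K : Set (Eucl n)}

lemma norm_inv_smul_mem_sphere {x : Eucl n} (hx : x ≠ 0) :
    ‖x‖⁻¹ • x ∈ Metric.sphere (0 : Eucl n) 1 := by
  rw [mem_sphere_zero_iff_norm, norm_smul, norm_inv, norm_norm,
    inv_mul_cancel₀ (norm_ne_zero_iff.2 hx)]

lemma hasFDerivAt_norm' {x : Eucl n} (hx : x ≠ 0) :
    HasFDerivAt (fun z : Eucl n => ‖z‖) (‖x‖⁻¹ • innerSL ℝ x) x := by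
  have hx' : ‖x‖ ≠ 0 := norm_ne_zero_iff.2 hx
  have h1 := (hasStrictFDerivAt_norm_sq x).hasFDerivAt.sqrt (pow_ne_zero 2 hx')
  simp only [Real.sqrt_sq (norm_nonneg _)] at h1
  have h2 : (‖x‖⁻¹ • innerSL ℝ x : Eucl n →L[ℝ] ℝ) =
      (1 / (2 * ‖x‖)) • (2 • innerSL ℝ x : Eucl n →L[ℝ] ℝ) := by
    ext1 v
    simp
    field_simp
  rw [h2]
  exact h1

lemma hasFDerivAt_normalize {x : Eucl n} (hx : x ≠ 0) :
    HasFDerivAt (fun z : Eucl n => ‖z‖⁻¹ • z)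
      (‖x‖⁻¹ • (ContinuousLinearMap.id ℝ (Eucl n) -
        (innerSL ℝ (‖x‖⁻¹ • x)).smulRight (‖x‖⁻¹ • x))) x := by
  have hx' : ‖x‖ ≠ 0 := norm_ne_zero_iff.2 hx
  have h1 := ((hasDerivAt_inv hx').comp_hasFDerivAt x (hasFDerivAt_norm' hx)).smul (hasFDerivAt_id x)
  refine h1.congr_fderiv ?_
  ext1 v
  simp only [_root_.smul_apply, _root_.sub_apply,
    _root_.add_apply, ContinuousLinearMap.smulRight_apply, innerSL_apply_apply,
    ContinuousLinearMap.id_apply, inner_smul_left, smul_sub, smul_smul, id]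
  simp
  match_scalars <;> field_simp

namespace IsSmoothBody

lemma mem_nhds_zero (hK : IsSmoothBody K) : K ∈ 𝓝 (0 : Eucl n) :=
  mem_interior_iff_mem_nhds.1 hK.zero_mem_interior

lemma mem_iff_gauge_le_one (hK : IsSmoothBody K) {x : Eucl n} : x ∈ K ↔ gauge K x ≤ 1 := by
  rw [gauge_le_one_iff_mem_closure hK.convex hK.mem_nhds_zero, hK.isCompact.isClosed.closure_eq]

lemma gauge_pos (hK : IsSmoothBody K) {x : Eucl n} (hx : x ≠ 0) : 0 < gauge K x :=
  (_root_.gauge_pos (absorbent_nhds_zero hK.mem_nhds_zero)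
    (NormedSpace.isVonNBounded_of_isBounded ℝ hK.isCompact.isBounded)).2 hx

lemma isGreatest_radial (hK : IsSmoothBody K) {ξ : Eucl n} (hξ : ξ ≠ 0) :
    IsGreatest {c : ℝ | 0 < c ∧ c • ξ ∈ K} (gauge K ξ)⁻¹ := by
  have hpos := hK.gauge_pos hξ
  refine ⟨⟨inv_pos.2 hpos, ?_⟩, fun c hc => ?_⟩
  · rw [hK.mem_iff_gauge_le_one, gauge_smul_of_nonneg (inv_pos.2 hpos).le, smul_eq_mul,
      inv_mul_cancel₀ hpos.ne']
  · have h1 := hK.mem_iff_gauge_le_one.1 hc.2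
    rw [gauge_smul_of_nonneg hc.1.le, smul_eq_mul] at h1
    rwa [← one_div, le_div_iff₀ hpos]

lemma radFun_eq (hK : IsSmoothBody K) (ξ : Eucl n) : radFun K ξ = (gauge K ξ)⁻¹ := by
  rcases eq_or_ne ξ 0 with rfl | hξ
  · have h1 : {c : ℝ | 0 < c ∧ c • (0 : Eucl n) ∈ K} = Set.Ioi 0 := by
      ext c
      simp [interior_subset hK.zero_mem_interior]
    rw [radFun, h1, Real.sSup_of_not_bddAbove (not_bddAbove_Ioi 0), gauge_zero, inv_zero]
  · exact (hK.isGreatest_radial hξ).csSup_eq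

lemma measurable_radFun (hK : IsSmoothBody K) : Measurable (radFun K) := by
  simp_rw [funext hK.radFun_eq]
  exact (continuous_gauge hK.convex hK.mem_nhds_zero).measurable.inv

lemma le_one_of_smul_gradient_mem (hK : IsSmoothBody K) {x : Eucl n} (hx : x ≠ 0) {c : ℝ}
    (h : c • gradient (suppFun K) x ∈ K) : c ≤ 1 := by
  have h1 := inner_le_suppFun hK.isCompact x h
  rw [inner_smul_right, hK.inner_gradient hx] at h1
  have := hK.suppFun_pos hx
  by_contra! h2
  nlinarith

lemma radFun_normalize_gradient (hK : IsSmoothBody K) {x : Eucl n} (hx : x ≠ 0) :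
    radFun K (‖gradient (suppFun K) x‖⁻¹ • gradient (suppFun K) x) =
      ‖gradient (suppFun K) x‖ := by
  have hy := norm_pos_iff.2 (hK.gradient_ne_zero hx)
  refine IsGreatest.csSup_eq ⟨⟨hy, ?_⟩, fun c hc => ?_⟩
  · rw [smul_smul, mul_inv_cancel₀ hy.ne', one_smul]
    exact hK.gradient_mem hx
  · have h1 := hc.2
    rw [smul_smul] at h1
    have h2 := hK.le_one_of_smul_gradient_mem hx h1
    rwa [← div_eq_mul_inv, div_le_one hy] at h2

lemma exists_gradient_eq_radial (hK : IsSmoothBody K) {ξ : Eucl n} (hξ : ξ ≠ 0) :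
    ∃ x : Eucl n, x ≠ 0 ∧ gradient (suppFun K) x = (gauge K ξ)⁻¹ • ξ := by
  set p := (gauge K ξ)⁻¹ • ξ with hp
  have hpos := hK.gauge_pos hξ
  have hg : gauge K p = 1 := by
    rw [hp, gauge_smul_of_nonneg (inv_pos.2 hpos).le, smul_eq_mul, inv_mul_cancel₀ hpos.ne']
  have hpK : p ∈ K := hK.mem_iff_gauge_le_one.2 hg.le
  have hpi : p ∉ interior K := by
    rw [← setOfPred_gauge_lt_one_eq_interior hK.convex hK.mem_nhds_zero]
    simp [hg]
  obtain ⟨φ, hφ⟩ := geometric_hahn_banach_open_point hK.convex.interior isOpen_interior hpi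
  set x := (InnerProductSpace.toDual ℝ (Eucl n)).symm φ with hx
  have hin : ∀ z, ⟪x, z⟫ = φ z := fun z => by
    rw [hx, InnerProductSpace.toDual_symm_apply]
  have hx0 : x ≠ 0 := by
    intro h0
    have h1 := hφ 0 hK.zero_mem_interior
    rw [← hin, ← hin, h0] at h1
    simp at h1
  refine ⟨x, hx0, hK.gradient_eq hx0 hpK (le_antisymm (inner_le_suppFun hK.isCompact x hpK) ?_)⟩
  have hle : K ⊆ {z | ⟪x, z⟫ ≤ ⟪x, p⟫} := by
    have h1 : K ⊆ closure (interior K) := by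
      rw [hK.convex.closure_interior_eq_closure_of_nonempty_interior ⟨0, hK.zero_mem_interior⟩]
      exact subset_closure
    refine h1.trans (closure_minimal (fun z hz => ?_) (isClosed_le (by fun_prop) (by fun_prop)))
    show ⟪x, z⟫ ≤ ⟪x, p⟫
    rw [hin, hin]
    exact (hφ z hz).le
  obtain ⟨y, hy, h⟩ := exists_inner_eq_suppFun hK.isCompact hK.nonempty x
  rw [← h]
  exact hle hy

lemma fderiv_gradient_eq_zero_of_gradient_eq (hK : IsSmoothBody K) {x x' : Eucl n} (hx : x ≠ 0)
    (hx' : x' ≠ 0) (h : gradient (suppFun K) x = gradient (suppFun K) x') :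
    fderiv ℝ (gradient (suppFun K)) x (x' - x) = 0 := by
  set y := gradient (suppFun K) x with hy
  have hxy : ⟪x, y⟫ = suppFun K x := hK.inner_gradient hx
  have hxy' : ⟪x', y⟫ = suppFun K x' := by rw [h, hK.inner_gradient hx']
  have hpos := hK.suppFun_pos hx
  have hpos' := hK.suppFun_pos hx'
  have hseg : ∀ s ∈ Set.Icc (0 : ℝ) 1, gradient (suppFun K) (x + s • (x' - x)) = y := by
    intro s hs
    have h1 : x + s • (x' - x) = (1 - s) • x + s • x' := by module
    have h2 : ⟪x + s • (x' - x), y⟫ = (1 - s) * suppFun K x + s * suppFun K x' := by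
      rw [h1, inner_add_left, inner_smul_left, inner_smul_left, hxy, hxy']
      simp
    have h3 : 0 < ⟪x + s • (x' - x), y⟫ := by
      rw [h2]
      rcases hs.1.eq_or_lt with h0 | h0
      · rw [← h0]; linarith
      · have := mul_nonneg (sub_nonneg.2 hs.2) hpos.le
        have := mul_pos h0 hpos'
        linarith
    have hne : x + s • (x' - x) ≠ 0 := by
      intro h0
      rw [h0, inner_zero_left] at h3
      exact lt_irrefl _ h3
    refine hK.gradient_eq hne (hK.gradient_mem hx)
      (le_antisymm (inner_le_suppFun hK.isCompact _ (hK.gradient_mem hx)) ?_)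
    obtain ⟨z, hz, hzeq⟩ :=
      exists_inner_eq_suppFun hK.isCompact hK.nonempty (x + s • (x' - x))
    rw [h2, ← hzeq, h1, inner_add_left, inner_smul_left, inner_smul_left]
    have h4 := inner_le_suppFun hK.isCompact x hz
    have h5 := inner_le_suppFun hK.isCompact x' hz
    have := mul_le_mul_of_nonneg_left h4 (sub_nonneg.2 hs.2)
    have := mul_le_mul_of_nonneg_left h5 hs.1
    simp only [conj_trivial]
    linarith
  have h1 : HasDerivAt (fun s : ℝ => x + s • (x' - x)) (x' - x) 0 := by
    simpa using ((hasDerivAt_id (0 : ℝ)).smul_const (x' - x)).const_add x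
  have h2 : HasDerivAt (fun s : ℝ => gradient (suppFun K) (x + s • (x' - x)))
      (fderiv ℝ (gradient (suppFun K)) x (x' - x)) 0 := by
    have h3 : HasFDerivAt (gradient (suppFun K)) (fderiv ℝ (gradient (suppFun K)) x)
        (x + (0 : ℝ) • (x' - x)) := by
      simpa using (hK.differentiableAt_gradient hx).hasFDerivAt
    exact h3.comp_hasDerivAt (0 : ℝ) h1
  have h3 : HasDerivWithinAt (fun s : ℝ => gradient (suppFun K) (x + s • (x' - x)))
      0 (Set.Icc 0 1) 0 :=
    (hasDerivWithinAt_const (0 : ℝ) (Set.Icc 0 1) y).congr hseg (hseg 0 ⟨le_rfl, zero_le_one⟩)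
  exact (uniqueDiffOn_Icc zero_lt_one 0 ⟨le_rfl, zero_le_one⟩).eq_deriv _ h2.hasDerivWithinAt h3

end IsSmoothBody

/-- The norm-preserving map of the punctured space sending the outer normal direction of a boundary
point to the direction of that point. -/
def radialMap (K : Set (Eucl n)) (x : Eucl n) : Eucl n :=
  ‖x‖ • (‖gradient (suppFun K) x‖⁻¹ • gradient (suppFun K) x)

namespace IsSmoothBody

lemma norm_radialMap (hK : IsSmoothBody K) {x : Eucl n} (hx : x ≠ 0) :
    ‖radialMap K x‖ = ‖x‖ := by
  have hy := norm_ne_zero_iff.2 (hK.gradient_ne_zero hx)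
  rw [radialMap, norm_smul, norm_smul, norm_inv, norm_norm, norm_norm, inv_mul_cancel₀ hy, mul_one]

lemma normalize_radialMap (hK : IsSmoothBody K) {x : Eucl n} (hx : x ≠ 0) :
    ‖radialMap K x‖⁻¹ • radialMap K x =
      ‖gradient (suppFun K) x‖⁻¹ • gradient (suppFun K) x := by
  rw [hK.norm_radialMap hx, radialMap, smul_smul, inv_mul_cancel₀ (norm_ne_zero_iff.2 hx),
    one_smul]

lemma det_fderiv_gradient_add_rankOne_ne_zero (hK : IsSmoothBody K) {x : Eucl n}
    (hx : x ∈ Metric.sphere (0 : Eucl n) 1) : LinearMap.det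
    ((fderiv ℝ (gradient (suppFun K)) x : Eucl n →ₗ[ℝ] Eucl n) + rankOne x) ≠ 0 :=
  (hK.curvDet_pos hx).ne'

lemma eq_of_gradient_eq (hK : IsSmoothBody K) {x x' : Eucl n} (hx : x ≠ 0) (hx' : x' ≠ 0)
    (hnorm : ‖x‖ = ‖x'‖) (h : gradient (suppFun K) x = gradient (suppFun K) x') : x = x' := by
  have hr : 0 < ‖x‖ := norm_pos_iff.2 hx
  set ω := ‖x‖⁻¹ • x with hω
  have hωs : ω ∈ Metric.sphere (0 : Eucl n) 1 := norm_inv_smul_mem_sphere hx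
  have hω1 : ‖ω‖ = 1 := by simpa using hωs
  have hω0 : ω ≠ 0 := by
    intro h0
    simp [h0] at hω1
  have hxω : x = ‖x‖ • ω := by
    rw [hω, smul_smul, mul_inv_cancel₀ hr.ne', one_smul]
  set w := x' - x with hw
  have h1 : fderiv ℝ (gradient (suppFun K)) ω w = 0 := by
    have h2 := hK.fderiv_gradient_eq_zero_of_gradient_eq hx hx' h
    have h3 := hK.fderiv_gradient_smul hx (inv_pos.2 hr)
    have h4 := congrArg (fun L : Eucl n →L[ℝ] Eucl n => L w) h3
    simp only [_root_.smul_apply] at h4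
    rw [h2] at h4
    exact (smul_eq_zero.1 h4).resolve_left (inv_pos.2 hr).ne'
  set G := (fderiv ℝ (gradient (suppFun K)) ω : Eucl n →ₗ[ℝ] Eucl n) + rankOne ω with hG
  have hGω : G ω = ω := by
    simp [hG, hK.fderiv_gradient_self hω0, rankOne, hω1]
  have hGw : G (w - ⟪ω, w⟫ • ω) = 0 := by
    rw [map_sub, map_smul, hGω]
    simp [hG, h1, rankOne]
  have hinj : Function.Injective G := by
    rw [← LinearMap.ker_eq_bot]
    by_contra hne
    exact hK.det_fderiv_gradient_add_rankOne_ne_zero hωs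
      (LinearMap.det_eq_zero_iff_ker_ne_bot.2 hne)
  have hwω : w = ⟪ω, w⟫ • ω := sub_eq_zero.1 (hinj (hGw.trans (map_zero G).symm))
  set c := ‖x‖ + ⟪ω, w⟫ with hc
  have hx'c : x' = c • ω := by
    have : x' = x + w := by rw [hw]; abel
    rw [hc, add_smul, ← hwω, ← hxω, this]
  have hcabs : |c| = ‖x‖ := by
    rw [hnorm, hx'c, norm_smul, hω1, mul_one, Real.norm_eq_abs]
  have hcpos : 0 < c := by
    have h5 := hK.inner_gradient hx'
    have h6 := hK.suppFun_pos hx'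
    have h7 := hK.inner_gradient hx
    have h8 := hK.suppFun_pos hx
    rw [← h5, ← h, hx'c, inner_smul_left] at h6
    rw [← h7] at h8
    nth_rewrite 1 [hxω] at h8
    rw [inner_smul_left] at h8
    simp only [conj_trivial] at h6 h8
    have h9 := (mul_pos_iff_of_pos_left hr).1 h8
    exact (mul_pos_iff_of_pos_right h9).1 h6
  rw [hx'c, ← abs_of_pos hcpos, hcabs, ← hxω]

lemma injOn_radialMap (hK : IsSmoothBody K) : Set.InjOn (radialMap K) {(0 : Eucl n)}ᶜ := by
  intro x hx x' hx' h
  have hx : x ≠ 0 := hx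
  have hx' : x' ≠ 0 := hx'
  refine hK.eq_of_gradient_eq hx hx' ?_ ?_
  · rw [← hK.norm_radialMap hx, h, hK.norm_radialMap hx']
  · have h1 := hK.normalize_radialMap hx
    rw [h, hK.normalize_radialMap hx'] at h1
    have h2 := hK.radFun_normalize_gradient hx
    rw [← h1, hK.radFun_normalize_gradient hx'] at h2
    rw [h2] at h1
    exact (smul_right_injective (Eucl n)
      (inv_ne_zero (norm_ne_zero_iff.2 (hK.gradient_ne_zero hx))) h1).symm

lemma image_radialMap_ball (hK : IsSmoothBody K) :
    radialMap K '' (Metric.ball (0 : Eucl n) 1 \ {0}) = Metric.ball (0 : Eucl n) 1 \ {0} := by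
  ext y
  constructor
  · rintro ⟨x, ⟨hx1, hx0⟩, rfl⟩
    have hx0 : x ≠ 0 := hx0
    have h := hK.norm_radialMap hx0
    refine ⟨?_, ?_⟩
    · rw [mem_ball_zero_iff, h]
      simpa using hx1
    · rw [Set.mem_singleton_iff, ← norm_eq_zero, h]
      exact norm_ne_zero_iff.2 hx0
  · rintro ⟨hy1, hy0⟩
    have hy0 : y ≠ 0 := hy0
    have hy : 0 < ‖y‖ := norm_pos_iff.2 hy0
    obtain ⟨x, hx0, hx⟩ := hK.exists_gradient_eq_radial hy0
    have hxn : 0 < ‖x‖ := norm_pos_iff.2 hx0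
    have hgp := inv_pos.2 (hK.gauge_pos hy0)
    have hc : 0 < ‖y‖ * ‖x‖⁻¹ := by positivity
    have hnorm : ‖(‖y‖ * ‖x‖⁻¹) • x‖ = ‖y‖ := by
      rw [norm_smul, Real.norm_of_nonneg hc.le, mul_assoc, inv_mul_cancel₀ hxn.ne', mul_one]
    refine ⟨(‖y‖ * ‖x‖⁻¹) • x, ⟨?_, smul_ne_zero hc.ne' hx0⟩, ?_⟩
    · rw [mem_ball_zero_iff, hnorm]
      simpa using hy1
    · rw [radialMap, hnorm, hK.gradient_smul hx0 hc, hx, norm_smul, Real.norm_of_nonneg hgp.le,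
        smul_smul, smul_smul]
      have : ‖y‖ * ((gauge K y)⁻¹ * ‖y‖)⁻¹ * (gauge K y)⁻¹ = 1 := by
        rw [mul_inv, mul_comm _ ‖y‖⁻¹, ← mul_assoc, mul_inv_cancel₀ hy.ne', one_mul,
          inv_mul_cancel₀ hgp.ne']
      rw [this, one_smul]

lemma hasFDerivAt_radialMap (hK : IsSmoothBody K) {x : Eucl n} (hx : x ≠ 0) :
    ∃ L : Eucl n →L[ℝ] Eucl n, HasFDerivAt (radialMap K) L x ∧
      L.det = suppFun K (‖x‖⁻¹ • x) * curvDet (suppFun K) (‖x‖⁻¹ • x) *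
        (‖gradient (suppFun K) x‖ ^ n)⁻¹ := by
  have hr : 0 < ‖x‖ := norm_pos_iff.2 hx
  set y := gradient (suppFun K) x with hy
  have hy0 : y ≠ 0 := hK.gradient_ne_zero hx
  have hyn : 0 < ‖y‖ := norm_pos_iff.2 hy0
  set ω := ‖x‖⁻¹ • x with hω
  set u := ‖y‖⁻¹ • y with hu
  have hωs : ω ∈ Metric.sphere (0 : Eucl n) 1 := norm_inv_smul_mem_sphere hx
  have hω1 : ‖ω‖ = 1 := by simpa using hωs
  have hu1 : ‖u‖ = 1 := by simpa using norm_inv_smul_mem_sphere hy0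
  have hω0 : ω ≠ 0 := smul_ne_zero (inv_pos.2 hr).ne' hx
  have hyu : y = ‖y‖ • u := by rw [hu, smul_smul, mul_inv_cancel₀ hyn.ne', one_smul]
  set D := fderiv ℝ (gradient (suppFun K)) ω with hD
  have hDx : ‖x‖ • fderiv ℝ (gradient (suppFun K)) x = D := by
    rw [← hK.fderiv_gradient_smul hx (inv_pos.2 hr), smul_smul, mul_inv_cancel₀ hr.ne', one_smul]
  have hgω : gradient (suppFun K) ω = y := hK.gradient_smul hx (inv_pos.2 hr)
  set h := suppFun K ω with hh
  have hh0 : 0 < h := hK.suppFun_pos hω0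
  have hωy : ⟪ω, y⟫ = h := by rw [← hgω, hK.inner_gradient hω0]
  have hωu : ⟪ω, u⟫ = ‖y‖⁻¹ * h := by rw [hu, inner_smul_right, hωy]
  have hωD : ∀ v, ⟪ω, D v⟫ = 0 := fun v => by
    have h1 := (isSymmetric_fderiv_gradient (hK.contDiffAt_two hω0)) ω v
    have h2 : D ω = 0 := hK.fderiv_gradient_self hω0
    have h3 : ⟪D ω, v⟫ = ⟪ω, D v⟫ := h1
    rw [← h3, h2, inner_zero_left]
  have hN := (hasFDerivAt_normalize hy0).comp x (hK.differentiableAt_gradient hx).hasFDerivAt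
  have hL := (hasFDerivAt_norm' hx).smul hN
  refine ⟨_, hL, ?_⟩
  set G : Eucl n →ₗ[ℝ] Eucl n := (D : Eucl n →ₗ[ℝ] Eucl n) + rankOne ω with hG
  set φ : Eucl n →ₗ[ℝ] ℝ := ((innerSL ℝ ω : Eucl n →L[ℝ] ℝ) : Eucl n →ₗ[ℝ] ℝ) with hφ
  set ψ : Eucl n →ₗ[ℝ] ℝ :=
    ((innerSL ℝ ((‖y‖ * h⁻¹) • ω - u) : Eucl n →L[ℝ] ℝ) : Eucl n →ₗ[ℝ] ℝ) with hψ
  have key : ∀ L : Eucl n →L[ℝ] Eucl n,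
      (∀ v, L v = ‖y‖⁻¹ • ((LinearMap.id + ψ.smulRight u : Eucl n →ₗ[ℝ] Eucl n)
        ((LinearMap.id + φ.smulRight (y - ω) : Eucl n →ₗ[ℝ] Eucl n) (G v)))) → L.det = h * curvDet (suppFun K) ω * (‖y‖ ^ n)⁻¹ := by
    intro L hLv
    have h1 : (L : Eucl n →ₗ[ℝ] Eucl n) = ‖y‖⁻¹ • ((LinearMap.id + ψ.smulRight u) ∘ₗ
        (LinearMap.id + φ.smulRight (y - ω)) ∘ₗ G) := by
      ext1 v
      exact hLv v
    have h2 : ψ u = 0 := by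
      simp only [hψ, ContinuousLinearMap.coe_coe, innerSL_apply_apply, inner_sub_left,
        inner_smul_left, hωu, real_inner_self_eq_norm_sq, hu1, conj_trivial]
      field_simp
      ring
    have h3 : φ (y - ω) = h - 1 := by
      simp only [hφ, ContinuousLinearMap.coe_coe, innerSL_apply_apply, inner_sub_right, hωy,
        real_inner_self_eq_norm_sq, hω1]
      norm_num
    have h4 : LinearMap.det G = curvDet (suppFun K) ω := rfl
    rw [ContinuousLinearMap.det, h1, LinearMap.det_smul, LinearMap.det_comp, LinearMap.det_comp,
      det_id_add_smulRight, det_id_add_smulRight, h2, h3, h4, finrank_euclideanSpace,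
      Fintype.card_fin, inv_pow]
    ring
  refine key _ fun v => ?_
  have hDv : fderiv ℝ (gradient (suppFun K)) x v = ‖x‖⁻¹ • D v := by
    rw [← hDx, _root_.smul_apply, smul_smul, inv_mul_cancel₀ hr.ne', one_smul]
  have hφG : φ (G v) = ⟪ω, v⟫ := by
    simp only [hφ, hG, rankOne, ContinuousLinearMap.coe_coe, innerSL_apply_apply,
      LinearMap.add_apply, LinearMap.coe_mk, AddHom.coe_mk, inner_add_right, hωD,
      inner_smul_right, real_inner_self_eq_norm_sq, hω1]
    ring
  have hGv : G v = D v + ⟪ω, v⟫ • ω := rfl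
  have hA : (LinearMap.id + φ.smulRight (y - ω) : Eucl n →ₗ[ℝ] Eucl n) (G v) = D v + ⟪ω, v⟫ • y := by
    simp only [LinearMap.add_apply, LinearMap.id_apply, LinearMap.smulRight_apply, hφG]
    rw [hGv]
    module
  have hψA : ψ (D v + ⟪ω, v⟫ • y) = - ⟪u, D v⟫ := by
    simp only [hψ, ContinuousLinearMap.coe_coe, innerSL_apply_apply, inner_sub_left,
      inner_smul_left, inner_add_right, inner_smul_right, hωD, hωy, conj_trivial]
    nth_rewrite 3 [hyu]
    rw [inner_smul_right, real_inner_self_eq_norm_sq, hu1]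
    field_simp
    ring
  rw [hA]
  simp only [LinearMap.add_apply, LinearMap.id_apply, LinearMap.smulRight_apply, hψA]
  simp only [_root_.add_apply, _root_.smul_apply,
    ContinuousLinearMap.smulRight_apply, ContinuousLinearMap.comp_apply,
    _root_.sub_apply, ContinuousLinearMap.id_apply, innerSL_apply_apply, hDv,
    Function.comp_apply, ← hy, ← hu]
  have hωv : ⟪ω, v⟫ = ‖x‖⁻¹ * ⟪x, v⟫ := by simp [hω, inner_smul_left]
  rw [hωv, inner_smul_right]
  have hyu' : (‖x‖⁻¹ * ⟪x, v⟫) • y = (‖x‖⁻¹ * ⟪x, v⟫ * ‖y‖) • u := by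
    conv_lhs => rw [hyu]
    rw [smul_smul]
  rw [hyu']
  simp only [smul_sub, smul_add, smul_smul, neg_smul, smul_neg, smul_eq_mul]
  match_scalars <;> field_simp
  ring

end IsSmoothBody

end RadialMap

section RadialIntegral

variable {n : ℕ} {K : Set (Eucl n)}

namespace IsSmoothBody

lemma continuousOn_suppFun (hK : IsSmoothBody K) : ContinuousOn (suppFun K) {(0 : Eucl n)}ᶜ :=
  hK.2.2.2.2.1.continuousOn

lemma continuousOn_curvDet (hK : IsSmoothBody K) :
    ContinuousOn (curvDet (suppFun K)) {(0 : Eucl n)}ᶜ := by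
  have h1 : ContinuousOn (fderiv ℝ (gradient (suppFun K))) {(0 : Eucl n)}ᶜ := fun x hx =>
    ((hK.contDiffAt_gradient hx).continuousAt_fderiv two_ne_zero).continuousWithinAt
  have h2 : Continuous fun x : Eucl n => (innerSL ℝ x : Eucl n →L[ℝ] ℝ).smulRight x :=
    ((ContinuousLinearMap.smulRightL ℝ (Eucl n) (Eucl n)).continuous.comp
      (innerSL ℝ).continuous).clm_apply continuous_id
  have h3 := ContinuousLinearMap.continuous_det.comp_continuousOn (h1.add h2.continuousOn)
  refine h3.congr fun x _ => ?_
  rw [curvDet, Function.comp_apply, ContinuousLinearMap.det]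
  congr 1

lemma setIntegral_radial_eq (hK : IsSmoothBody K) (hn : 1 ≤ n) {v : Eucl n → ℝ}
    (hv : Continuous v) :
    ∫ ξ in Metric.sphere (0 : Eucl n) 1, v (radFun K ξ • ξ) * radFun K ξ ^ n ∂μH[(n : ℝ) - 1] =
      ∫ x in Metric.sphere (0 : Eucl n) 1,
        v (gradient (suppFun K) x) * suppFun K x * curvDet (suppFun K) x ∂μH[(n : ℝ) - 1] := by
  obtain ⟨c, hc⟩ := exists_setIntegral_sphere_eq hn
  have hm1 : Measurable fun ξ => v (radFun K ξ • ξ) * radFun K ξ ^ n :=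
    (hv.measurable.comp (hK.measurable_radFun.smul measurable_id)).mul
      (hK.measurable_radFun.pow_const n)
  have hm2 : Measurable fun x =>
      v (gradient (suppFun K) x) * suppFun K x * curvDet (suppFun K) x :=
    measurable_of_continuousOn_compl_singleton 0
      (((hv.comp_continuousOn hK.continuousOn_gradient).mul hK.continuousOn_suppFun).mul
        hK.continuousOn_curvDet)
  rw [hc _ hm1, hc _ hm2]
  congr 1
  have : Nonempty (Fin n) := ⟨⟨0, hn⟩⟩
  have hae : (Metric.ball (0 : Eucl n) 1 : Set (Eucl n)) =ᵐ[volume]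
      (Metric.ball (0 : Eucl n) 1 \ {0} : Set (Eucl n)) :=
    (sdiff_null_ae_eq_self (measure_singleton (0 : Eucl n))).symm
  rw [setIntegral_congr_set hae, setIntegral_congr_set hae]
  choose! L hL using fun (x : Eucl n) (hx : x ≠ 0) => hK.hasFDerivAt_radialMap hx
  have hms : MeasurableSet (Metric.ball (0 : Eucl n) 1 \ {0}) :=
    measurableSet_ball.diff (measurableSet_singleton _)
  have hcv := integral_image_eq_integral_abs_det_fderiv_smul (f' := L) volume hms
    (fun x hx => (hL x hx.2).1.hasFDerivWithinAt)
    (hK.injOn_radialMap.mono fun x hx => hx.2)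
    (fun x => v (radFun K (‖x‖⁻¹ • x) • (‖x‖⁻¹ • x)) * radFun K (‖x‖⁻¹ • x) ^ n)
  rw [hK.image_radialMap_ball] at hcv
  rw [hcv]
  refine setIntegral_congr_fun hms fun x hx => ?_
  have hx0 : x ≠ 0 := hx.2
  have hyn : 0 < ‖gradient (suppFun K) x‖ := norm_pos_iff.2 (hK.gradient_ne_zero hx0)
  have hω := norm_inv_smul_mem_sphere hx0
  have h1 := hK.suppFun_pos (smul_ne_zero (inv_ne_zero (norm_ne_zero_iff.2 hx0)) hx0)
  have h2 := hK.curvDet_pos hω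
  simp only [(hL x hx0).2, hK.normalize_radialMap hx0, hK.radFun_normalize_gradient hx0,
    hK.gradient_smul hx0 (inv_pos.2 (norm_pos_iff.2 hx0)), smul_eq_mul, smul_smul,
    mul_inv_cancel₀ hyn.ne', one_smul]
  rw [abs_of_pos (by positivity)]
  field_simp

end IsSmoothBody

end RadialIntegral

section SupportBarrier

variable {n : ℕ}

lemma subset_closedBall_of_suppFun_le {K : Set (Eucl n)} (hK : IsCompact K) {R : ℝ} (hR : 0 ≤ R)
    (h : ∀ x ∈ Metric.sphere (0 : Eucl n) 1, suppFun K x ≤ R) : K ⊆ Metric.closedBall 0 R := by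
  intro y hy
  rw [mem_closedBall_zero_iff]
  rcases eq_or_ne y 0 with rfl | hy0
  · simpa using hR
  have h1 := (inner_le_suppFun hK (‖y‖⁻¹ • y) hy).trans (h _ (norm_inv_smul_mem_sphere hy0))
  rw [real_inner_smul_left, real_inner_self_eq_norm_sq] at h1
  have : 0 < ‖y‖ := norm_pos_iff.2 hy0
  calc ‖y‖ = ‖y‖⁻¹ * ‖y‖ ^ 2 := by field_simp
    _ ≤ R := h1

lemma closedBall_subset_of_le_suppFun {K : Set (Eucl n)} (hK : IsCompact K) (hconv : Convex ℝ K)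
    (hne : K.Nonempty) {r : ℝ} (h : ∀ x ∈ Metric.sphere (0 : Eucl n) 1, r ≤ suppFun K x) :
    Metric.closedBall 0 r ⊆ K := by
  intro y hy
  rw [mem_closedBall_zero_iff] at hy
  by_contra hyK
  obtain ⟨φ, u, hφ, hu⟩ := geometric_hahn_banach_closed_point hconv hK.isClosed hyK
  set v : Eucl n := (InnerProductSpace.toDual ℝ (Eucl n)).symm φ with hv
  have hvφ : ∀ z, ⟪v, z⟫ = φ z := fun z => InnerProductSpace.toDual_symm_apply
  obtain ⟨z, hz, hzv⟩ := exists_inner_eq_suppFun hK hne v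
  have hv0 : v ≠ 0 := by
    intro h0
    have h1 := hφ z hz
    rw [← hvφ, h0, inner_zero_left] at h1
    rw [← hvφ, h0, inner_zero_left] at hu
    linarith
  have hpos : 0 < ‖v‖ := norm_pos_iff.2 hv0
  have h1 : suppFun K v < φ y := by
    rw [← hzv, hvφ]
    exact (hφ z hz).trans hu
  have h2 : φ y ≤ ‖v‖ * r := by
    rw [← hvφ]
    exact (real_inner_le_norm v y).trans (mul_le_mul_of_nonneg_left hy hpos.le)
  have h3 := h _ (norm_inv_smul_mem_sphere hv0)
  rw [suppFun_smul hK hne (inv_nonneg.2 hpos.le), ← div_eq_inv_mul, le_div_iff₀ hpos] at h3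
  linarith

lemma HasDerivWithinAt.nonpos_of_isMinOn_Icc {g : ℝ → ℝ} {a b t d : ℝ} (hat : a < t) (htb : t ≤ b)
    (hmin : IsMinOn g (Set.Icc a b) t) (hd : HasDerivWithinAt g d (Set.Icc a b) t) : d ≤ 0 := by
  have hseg : segment ℝ t a ⊆ Set.Icc a b := by
    rw [segment_symm, segment_eq_Icc hat.le]
    exact Set.Icc_subset_Icc_right htb
  have h := hmin.localize.hasFDerivWithinAt_nonneg hd.hasFDerivWithinAt
    (sub_mem_posTangentConeAt_of_segment_subset hseg)
  simp only [ContinuousLinearMap.toSpanSingleton_apply, smul_eq_mul] at h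
  nlinarith

/-- Continuity of the support function jointly in the direction and in time. -/
lemma continuousOn_suppFun_prod {K : ℝ → Set (Eucl n)} {I : Set ℝ} {R : ℝ}
    (hK : ∀ t ∈ I, IsSmoothBody (K t)) (hR : ∀ t ∈ I, K t ⊆ Metric.closedBall 0 R)
    {S : Set (Eucl n)} (hc : ∀ x ∈ S, ContinuousOn (fun t => suppFun (K t) x) I) :
    ContinuousOn (fun z : Eucl n × ℝ => suppFun (K z.2) z.1) (S ×ˢ I) := by
  refine continuousOn_prod_of_continuousOn_lipschitzOnWith _ R.toNNReal hc fun t ht => ?_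
  refine LipschitzOnWith.of_le_add_mul _ fun x _ y _ => ?_
  refine (suppFun_le_add (hK t ht).isCompact (hK t ht).nonempty (hR t ht) x y).trans ?_
  rw [dist_eq_norm]
  gcongr
  exact Real.le_coe_toNNReal R

/-- A body whose support function moves inwards at most with speed `M` times its Gauss curvature
stays outside a slowly shrinking translated homothetic copy of a fixed smooth body. -/
lemma mul_one_sub_le_suppFun {K : ℝ → Set (Eucl n)} {L : Set (Eucl n)} {t₀ t₁ R M m κ b : ℝ}
    (hK : ∀ t ∈ Set.Icc t₀ t₁, IsSmoothBody (K t)) (hL : IsSmoothBody L)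
    (hR : ∀ t ∈ Set.Icc t₀ t₁, K t ⊆ Metric.closedBall 0 R) (hM : 0 ≤ M)
    (hflow : ∀ t ∈ Set.Icc t₀ t₁, ∀ x ∈ Metric.sphere (0 : Eucl n) 1, ∃ d,
      -M / curvDet (suppFun (K t)) x ≤ d ∧
        HasDerivWithinAt (fun s => suppFun (K s) x) d (Set.Icc t₀ t₁) t)
    (hb : 0 < b) (hb1 : b ≤ 1) (p : Eucl n) (hm : 0 < m)
    (hw : ∀ x ∈ Metric.sphere (0 : Eucl n) 1, m ≤ b * suppFun L x + ⟪p, x⟫)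
    (hκ : 0 < κ) (hLκ : ∀ x ∈ Metric.sphere (0 : Eucl n) 1, κ ≤ curvDet (suppFun L) x)
    (h0 : ∀ x ∈ Metric.sphere (0 : Eucl n) 1, b * suppFun L x + ⟪p, x⟫ ≤ suppFun (K t₀) x)
    {t : ℝ} (ht : t ∈ Set.Icc t₀ t₁) {x : Eucl n} (hx : x ∈ Metric.sphere (0 : Eucl n) 1) :
    (b * suppFun L x + ⟪p, x⟫) * (1 - ((n + 1) * M / (b ^ n * κ * m) + 1) * (t - t₀))
      ≤ suppFun (K t) x := by
  set B : ℝ := (n + 1) * M / (b ^ n * κ * m) + 1 with hB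
  have hB0 : 0 < B := by positivity
  set S : Set (Eucl n) := Metric.sphere 0 1 with hS
  set w : Eucl n → ℝ := fun z => b * suppFun L z + ⟪p, z⟫ with hwdef
  have hS0 : ∀ z ∈ S, z ≠ 0 := fun z hz => ne_zero_of_mem_unit_sphere ⟨z, hz⟩
  have hwpos : ∀ z ∈ S, 0 < w z := fun z hz => hm.trans_le (hw z hz)
  have hwc : ContinuousOn w S :=
    (continuousOn_const.mul (hL.continuousOn_suppFun.mono fun z hz => hS0 z hz)).add (by fun_prop)
  set g : Eucl n × ℝ → ℝ := fun z => (suppFun (K z.2) z.1 / w z.1) ^ (n + 1) + B * (z.2 - t₀)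
    with hg
  have hgc : ContinuousOn g (S ×ˢ Set.Icc t₀ t₁) := by
    have h1 := continuousOn_suppFun_prod hK hR (S := S) fun z hz s hs =>
      (hflow s hs z hz).choose_spec.2.continuousWithinAt
    have h2 : ContinuousOn (fun z : Eucl n × ℝ => w z.1) (S ×ˢ Set.Icc t₀ t₁) :=
      hwc.comp continuousOn_fst fun z hz => hz.1
    exact ((h1.div h2 fun z hz => (hwpos z.1 hz.1).ne').pow _).add (by fun_prop)
  obtain ⟨⟨y, τ⟩, ⟨hy, hτ⟩, hmin⟩ := ((isCompact_sphere (0 : Eucl n) 1).prod isCompact_Icc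
    (s := S) (t := Set.Icc t₀ t₁)).exists_isMinOn ⟨(x, t), hx, ht⟩ hgc
  have hHpos : ∀ s ∈ Set.Icc t₀ t₁, ∀ z ∈ S, 0 < suppFun (K s) z := fun s hs z hz =>
    (hK s hs).suppFun_pos (hS0 z hz)
  have key : 1 ≤ g (y, τ) := by
    by_contra! hlt
    set l : ℝ := suppFun (K τ) y / w y with hl
    have hl0 : 0 < l := div_pos (hHpos τ hτ y hy) (hwpos y hy)
    have hτ0 : 0 ≤ τ - t₀ := sub_nonneg.2 hτ.1
    have hl1 : l < 1 := by
      have : l ^ (n + 1) < 1 := lt_of_le_of_lt (by simp only [hg, ← hl]; nlinarith) hlt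
      exact (pow_lt_one_iff_of_nonneg hl0.le (by simp)).1 this
    have hτt : t₀ < τ := by
      refine lt_of_le_of_ne hτ.1 fun h => ?_
      have : 1 ≤ l := by
        rw [hl, one_le_div (hwpos y hy), ← h]
        exact h0 y hy
      linarith
    obtain ⟨d, hdM, hd⟩ := hflow τ hτ y hy
    have htouch : (l * b) ^ n * curvDet (suppFun L) y ≤ curvDet (suppFun (K τ)) y := by
      refine curvDet_ge_of_touching (hK τ hτ) hL (by positivity) (by nlinarith) (l • p) hy ?_ ?_
      · intro z
        rcases eq_or_ne z 0 with rfl | hz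
        · have e1 := suppFun_smul hL.isCompact hL.nonempty le_rfl (0 : Eucl n)
          have e2 := suppFun_smul (hK τ hτ).isCompact (hK τ hτ).nonempty le_rfl (0 : Eucl n)
          simp only [smul_zero, zero_mul] at e1 e2
          simp [e1, e2]
        · have hz' := norm_inv_smul_mem_sphere hz
          have hmz : g (y, τ) ≤ g (‖z‖⁻¹ • z, τ) := hmin (Set.mk_mem_prod hz' hτ)
          have h1 : l ^ (n + 1) ≤ (suppFun (K τ) (‖z‖⁻¹ • z) / w (‖z‖⁻¹ • z)) ^ (n + 1) := by
            simpa only [hg, add_le_add_iff_right] using hmz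
          have h2 := (pow_le_pow_iff_left₀ hl0.le
            (div_pos (hHpos τ hτ _ hz') (hwpos _ hz')).le (by simp)).1 h1
          rw [le_div_iff₀ (hwpos _ hz')] at h2
          have hzp : 0 < ‖z‖⁻¹ := inv_pos.2 (norm_pos_iff.2 hz)
          simp only [hwdef, suppFun_smul hL.isCompact hL.nonempty hzp.le,
            suppFun_smul (hK τ hτ).isCompact (hK τ hτ).nonempty hzp.le, inner_smul_right] at h2
          rw [real_inner_smul_left]
          refine le_of_mul_le_mul_left ?_ hzp
          linarith
      · rw [real_inner_smul_left]
        have : l * w y = suppFun (K τ) y := div_mul_cancel₀ _ (hwpos y hy).ne'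
        simp only [hwdef] at this
        linarith
    have hgd : HasDerivWithinAt (fun s => g (y, s)) ((n + 1) * l ^ n * (d / w y) + B)
        (Set.Icc t₀ t₁) τ := by
      have h1 := ((hd.div_const (w y)).pow (n + 1)).add
        (((hasDerivWithinAt_id τ (Set.Icc t₀ t₁)).sub_const t₀).const_mul B)
      refine h1.congr_deriv ?_
      simp [hl]
    have hmin' : IsMinOn (fun s => g (y, s)) (Set.Icc t₀ t₁) τ := fun s hs =>
      hmin (Set.mk_mem_prod hy hs)
    have hneg := hgd.nonpos_of_isMinOn_Icc hτt hτ.2 hmin'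
    have hcpos : 0 < (l * b) ^ n * κ := by positivity
    have hc : (l * b) ^ n * κ ≤ curvDet (suppFun (K τ)) y :=
      (mul_le_mul_of_nonneg_left (hLκ y hy) (by positivity)).trans htouch
    have hd1 : -(M / ((l * b) ^ n * κ)) ≤ d := by
      refine le_trans ?_ hdM
      rw [neg_div, neg_le_neg_iff]
      exact div_le_div_of_nonneg_left hM hcpos hc
    have hd2 : -(M / ((l * b) ^ n * κ)) / m ≤ d / w y := by
      rw [neg_div, neg_le, ← neg_div]
      calc -d / w y ≤ (M / ((l * b) ^ n * κ)) / w y :=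
            div_le_div_of_nonneg_right (by linarith) (hwpos y hy).le
        _ ≤ (M / ((l * b) ^ n * κ)) / m :=
            div_le_div_of_nonneg_left (by positivity) hm (hw y hy)
    have hd3 : (n + 1) * l ^ n * (-(M / ((l * b) ^ n * κ)) / m) ≤ (n + 1) * l ^ n * (d / w y) :=
      mul_le_mul_of_nonneg_left hd2 (by positivity)
    have hd4 : (n + 1) * l ^ n * (-(M / ((l * b) ^ n * κ)) / m) = 1 - B := by
      rw [hB, mul_pow]
      field_simp
      ring
    linarith
  have hfin : 1 ≤ g (x, t) := key.trans (hmin (Set.mk_mem_prod hx ht))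
  set l : ℝ := suppFun (K t) x / w x with hl
  have hl0 : 0 < l := div_pos (hHpos t ht x hx) (hwpos x hx)
  have hτ0 : 0 ≤ B * (t - t₀) := mul_nonneg hB0.le (sub_nonneg.2 ht.1)
  have hlw : l * w x = suppFun (K t) x := div_mul_cancel₀ _ (hwpos x hx).ne'
  have hl2 : 1 - B * (t - t₀) ≤ l := by
    rcases le_total l 1 with h1 | h1
    · have : l ^ (n + 1) ≤ l := pow_le_of_le_one hl0.le h1 (by simp)
      have h3 : 1 ≤ l ^ (n + 1) + B * (t - t₀) := hfin
      linarith
    · linarith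
  calc w x * (1 - B * (t - t₀)) ≤ w x * l := mul_le_mul_of_nonneg_left hl2 (hwpos x hx).le
    _ = suppFun (K t) x := by rw [mul_comm, hlw]

end SupportBarrier

section FlowBounds

variable {n : ℕ} {q T : ℝ} {f : Eucl n → ℝ} {K : ℝ → Set (Eucl n)}

lemma radFun_nonneg (K : Set (Eucl n)) (ξ : Eucl n) : 0 ≤ radFun K ξ :=
  Real.sSup_nonneg fun _ h => h.1.le

lemma theta_nonneg (hf : ∀ x ∈ Metric.sphere (0 : Eucl n) 1, 0 < f x) (K : Set (Eucl n)) :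
    0 ≤ theta q 0 f K := by
  refine div_nonneg (setIntegral_nonneg Metric.isClosed_sphere.measurableSet fun ξ _ => ?_)
    (setIntegral_nonneg Metric.isClosed_sphere.measurableSet fun x hx => ?_)
  · exact mul_nonneg (Vtilde_nonneg _ _ _) (pow_nonneg (radFun_nonneg _ _) _)
  · simpa using (hf x hx).le

lemma exists_theta_le (hn : 1 ≤ n) (hq : 1 < q)
    (hf : ∀ x ∈ Metric.sphere (0 : Eucl n) 1, 0 < f x) {R : ℝ} (hR0 : 0 ≤ R) :
    ∃ C, 0 ≤ C ∧ ∀ K : Set (Eucl n), IsSmoothBody K → K ⊆ Metric.closedBall 0 R →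
      theta q 0 f K ≤ C := by
  obtain ⟨C, hC0, hC⟩ := exists_Vtilde_le hn hq R (n := n)
  have hA : 0 ≤ ∫ x in Metric.sphere (0 : Eucl n) 1, f x ∂μH[(n : ℝ) - 1] :=
    setIntegral_nonneg Metric.isClosed_sphere.measurableSet fun x hx => (hf x hx).le
  refine ⟨(C * R ^ n * (μH[(n : ℝ) - 1] : Measure (Eucl n)).real (Metric.sphere 0 1)) /
    ∫ x in Metric.sphere (0 : Eucl n) 1, f x ∂μH[(n : ℝ) - 1], by positivity, fun K hK hR => ?_⟩
  simp only [theta, Real.rpow_zero, one_mul]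
  refine div_le_div_of_nonneg_right ((Real.le_norm_self _).trans
    (norm_setIntegral_le_of_norm_le_const (hausdorffMeasure_sphere_lt_top hn) fun ξ hξ => ?_)) hA
  have hξ0 : ξ ≠ 0 := ne_zero_of_mem_unit_sphere ⟨ξ, hξ⟩
  have hmem : radFun K ξ • ξ ∈ K := by
    rw [hK.radFun_eq]
    exact (hK.isGreatest_radial hξ0).1.2
  have hle : radFun K ξ ≤ R := by
    have := mem_closedBall_zero_iff.1 (hR hmem)
    rwa [norm_smul, mem_sphere_zero_iff_norm.1 hξ, mul_one, Real.norm_eq_abs,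
      abs_of_nonneg (radFun_nonneg _ _)] at this
  rw [Real.norm_eq_abs, abs_of_nonneg (mul_nonneg (Vtilde_nonneg _ _ _)
    (pow_nonneg (radFun_nonneg _ _) _))]
  exact mul_le_mul (hC K hK.isCompact hR _ (hR hmem))
    (pow_le_pow_left₀ (radFun_nonneg _ _) hle n) (pow_nonneg (radFun_nonneg _ _) _) hC0

lemma flowRHS_zero_eq (q : ℝ) (f : Eucl n → ℝ) (K : Set (Eucl n)) (x : Eucl n) :
    flowRHS q 0 f K x = suppFun K x -
      (theta q 0 f K * f x / Vtilde q K (gradient (suppFun K) x)) / curvDet (suppFun K) x := by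
  simp only [flowRHS, Real.rpow_zero, mul_one]
  ring

lemma flowRHS_zero_le (hf : ∀ x ∈ Metric.sphere (0 : Eucl n) 1, 0 < f x) {K : Set (Eucl n)}
    (hK : IsSmoothBody K) {x : Eucl n} (hx : x ∈ Metric.sphere (0 : Eucl n) 1) :
    flowRHS q 0 f K x ≤ suppFun K x := by
  rw [flowRHS_zero_eq]
  exact sub_le_self _ (div_nonneg (div_nonneg (mul_nonneg (theta_nonneg hf K) (hf x hx).le)
    (Vtilde_nonneg _ _ _)) (hK.curvDet_pos hx).le)

lemma exists_le_flowRHS_zero (hn : 1 ≤ n) (hq : 1 < q) (hfc : Continuous f)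
    (hf : ∀ x ∈ Metric.sphere (0 : Eucl n) 1, 0 < f x) {r R : ℝ} (hr : 0 < r) (hR0 : 0 ≤ R) :
    ∃ M, 0 ≤ M ∧ ∀ K : Set (Eucl n), IsSmoothBody K → K ⊆ Metric.closedBall 0 R →
      Metric.closedBall 0 r ⊆ K → ∀ x ∈ Metric.sphere (0 : Eucl n) 1,
        -M / curvDet (suppFun K) x ≤ flowRHS q 0 f K x := by
  obtain ⟨Θ, hΘ0, hΘ⟩ := exists_theta_le hn hq hf hR0
  obtain ⟨c, hc0, hc⟩ := exists_le_Vtilde hn hq hr (R := R) (n := n)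
  obtain ⟨F, hF⟩ := (isCompact_sphere (0 : Eucl n) 1).bddAbove_image hfc.continuousOn
  have hF' : ∀ x ∈ Metric.sphere (0 : Eucl n) 1, f x ≤ max F 0 := fun x hx =>
    (hF ⟨x, hx, rfl⟩).trans (le_max_left _ _)
  refine ⟨Θ * max F 0 / c, by positivity, fun K hK hKR hrK x hx => ?_⟩
  have hx0 : x ≠ 0 := ne_zero_of_mem_unit_sphere ⟨x, hx⟩
  have hx1 : ‖x‖ = 1 := mem_sphere_zero_iff_norm.1 hx
  have hH : r ≤ suppFun K x := by
    have := mul_norm_le_suppFun hK.isCompact hr.le hrK x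
    rwa [hx1, mul_one] at this
  have hg1 : r ≤ ‖gradient (suppFun K) x‖ := by
    have h1 := real_inner_le_norm x (gradient (suppFun K) x)
    rw [hK.inner_gradient hx0, hx1, one_mul] at h1
    exact hH.trans h1
  have hg2 : ‖gradient (suppFun K) x‖ ≤ R :=
    mem_closedBall_zero_iff.1 (hKR (hK.gradient_mem hx0))
  have hV := hc K hK.isCompact hKR hrK _ hg1 hg2
  have h1 : theta q 0 f K * f x / Vtilde q K (gradient (suppFun K) x) ≤ Θ * max F 0 / c := by
    refine div_le_div₀ (by positivity) ?_ hc0 hV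
    exact mul_le_mul (hΘ K hK hKR) (hF' x hx) (hf x hx).le hΘ0
  rw [flowRHS_zero_eq]
  have h2 := div_le_div_of_nonneg_right h1 (hK.curvDet_pos hx).le
  rw [neg_div]
  linarith

/-- Along the flow, the expanding rescaling `e^{-t} h` of the support function decreases. -/
lemma antitoneOn_exp_neg_mul_suppFun (hf : ∀ x ∈ Metric.sphere (0 : Eucl n) 1, 0 < f x)
    (hK : ∀ t ∈ Set.Ico (0 : ℝ) T, IsSmoothBody (K t))
    (hflow : IsGaussChordFlow q 0 f (Set.Ico 0 T) K) {x : Eucl n}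
    (hx : x ∈ Metric.sphere (0 : Eucl n) 1) :
    AntitoneOn (fun t => Real.exp (-t) * suppFun (K t) x) (Set.Ico 0 T) := by
  have hd : ∀ t ∈ Set.Ico 0 T, HasDerivWithinAt (fun t => Real.exp (-t) * suppFun (K t) x)
      (Real.exp (-t) * (flowRHS q 0 f (K t) x - suppFun (K t) x)) (Set.Ico 0 T) t := by
    intro t ht
    have h1 := (((hasDerivAt_id t).neg.exp).hasDerivWithinAt (s := Set.Ico 0 T)).mul
      (hflow t ht x hx)
    refine h1.congr_deriv ?_
    simp
    ring
  refine antitoneOn_of_deriv_nonpos (convex_Ico 0 T)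
    (fun t ht => (hd t ht).continuousWithinAt)
    (fun t ht => ((hd t (interior_subset ht)).hasDerivAt
      (mem_interior_iff_mem_nhds.1 ht)).differentiableAt.differentiableWithinAt) fun t ht => ?_
  rw [((hd t (interior_subset ht)).hasDerivAt (mem_interior_iff_mem_nhds.1 ht)).deriv]
  exact mul_nonpos_of_nonneg_of_nonpos (Real.exp_pos _).le
    (sub_nonpos.2 (flowRHS_zero_le hf (hK t (interior_subset ht)) hx))

lemma suppFun_le_exp_mul (hf : ∀ x ∈ Metric.sphere (0 : Eucl n) 1, 0 < f x)
    (hK : ∀ t ∈ Set.Ico (0 : ℝ) T, IsSmoothBody (K t))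
    (hflow : IsGaussChordFlow q 0 f (Set.Ico 0 T) K) {x : Eucl n}
    (hx : x ∈ Metric.sphere (0 : Eucl n) 1) {a b : ℝ} (ha : 0 ≤ a) (hab : a ≤ b) (hb : b < T) :
    suppFun (K b) x ≤ Real.exp (b - a) * suppFun (K a) x := by
  have h := antitoneOn_exp_neg_mul_suppFun hf hK hflow hx ⟨ha, hab.trans_lt hb⟩
    ⟨ha.trans hab, hb⟩ hab
  have h2 := mul_le_mul_of_nonneg_left h (Real.exp_pos b).le
  simp only [← mul_assoc, ← Real.exp_add] at h2
  simpa [sub_eq_add_neg] using h2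

lemma exists_ball_bounds (hf : ∀ x ∈ Metric.sphere (0 : Eucl n) 1, 0 < f x)
    (hK : ∀ t ∈ Set.Ico (0 : ℝ) T, IsSmoothBody (K t))
    (hflow : IsGaussChordFlow q 0 f (Set.Ico 0 T) K) {s : ℝ} (hs : s ∈ Set.Ico 0 T) :
    ∃ r R, 0 < r ∧ 0 < R ∧ ∀ t ∈ Set.Icc 0 s,
      K t ⊆ Metric.closedBall 0 R ∧ Metric.closedBall 0 r ⊆ K t := by
  have h0 : (0 : ℝ) ∈ Set.Ico 0 T := ⟨le_rfl, hs.1.trans_lt hs.2⟩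
  obtain ⟨R, hR0, hR⟩ := (hK 0 h0).isCompact.isBounded.exists_pos_norm_le
  obtain ⟨r, hr0, hr⟩ := exists_closedBall_subset (hK s hs).zero_mem_interior
  refine ⟨Real.exp (-s) * r, Real.exp s * R, by positivity, by positivity, fun t ht => ⟨?_, ?_⟩⟩
  · refine subset_closedBall_of_suppFun_le (hK t ⟨ht.1, ht.2.trans_lt hs.2⟩).isCompact
      (by positivity) fun x hx => ?_
    have h1 := suppFun_le_exp_mul hf hK hflow hx le_rfl ht.1 (ht.2.trans_lt hs.2)
    obtain ⟨y, hy, hyx⟩ := exists_inner_eq_suppFun (hK 0 h0).isCompact (hK 0 h0).nonempty x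
    have h2 : suppFun (K 0) x ≤ R := by
      rw [← hyx]
      refine (real_inner_le_norm x y).trans ?_
      rw [mem_sphere_zero_iff_norm.1 hx, one_mul]
      exact hR y hy
    refine h1.trans (mul_le_mul (Real.exp_le_exp.2 (by linarith [ht.2])) h2
      ((hK 0 h0).suppFun_pos (ne_zero_of_mem_unit_sphere ⟨x, hx⟩)).le (Real.exp_pos _).le)
  · have hKt := hK t ⟨ht.1, ht.2.trans_lt hs.2⟩
    refine closedBall_subset_of_le_suppFun hKt.isCompact hKt.convex hKt.nonempty fun x hx => ?_
    have h1 := suppFun_le_exp_mul hf hK hflow hx ht.1 ht.2 hs.2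
    have h2 := mul_norm_le_suppFun (hK s hs).isCompact hr0.le hr x
    rw [mem_sphere_zero_iff_norm.1 hx, mul_one] at h2
    have h3 : Real.exp (s - t) ≤ Real.exp s := Real.exp_le_exp.2 (by linarith [ht.1])
    have h4 : 0 < suppFun (K t) x := hKt.suppFun_pos (ne_zero_of_mem_unit_sphere ⟨x, hx⟩)
    rw [Real.exp_neg, inv_mul_le_iff₀ (Real.exp_pos s)]
    exact h2.trans (h1.trans (mul_le_mul_of_nonneg_right h3 h4.le))

end FlowBounds

section FlowLipschitz

variable {n : ℕ} {q T : ℝ} {f : Eucl n → ℝ} {K : ℝ → Set (Eucl n)}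

lemma IsSmoothBody.exists_pos_le_curvDet {K : Set (Eucl n)} (hK : IsSmoothBody K) :
    ∃ κ, 0 < κ ∧ ∀ x ∈ Metric.sphere (0 : Eucl n) 1, κ ≤ curvDet (suppFun K) x :=
  (isCompact_sphere (0 : Eucl n) 1).exists_forall_le' (hK.continuousOn_curvDet.mono fun x hx =>
    ne_zero_of_mem_unit_sphere ⟨x, hx⟩) fun _ hx => hK.curvDet_pos hx

lemma suppFun_le_of_subset_closedBall {K : Set (Eucl n)} (hK : IsCompact K) (hne : K.Nonempty)
    {R : ℝ} (hR : K ⊆ Metric.closedBall 0 R) {x : Eucl n} (hx : x ∈ Metric.sphere (0 : Eucl n) 1) :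
    suppFun K x ≤ R := by
  obtain ⟨y, hy, hyx⟩ := exists_inner_eq_suppFun hK hne x
  rw [← hyx]
  refine (real_inner_le_norm x y).trans ?_
  rw [mem_sphere_zero_iff_norm.1 hx, one_mul]
  exact mem_closedBall_zero_iff.1 (hR hy)

set_option maxHeartbeats 400000 in
/-- Along the flow, the support function is Lipschitz in time at `s`, uniformly in the direction
and locally uniformly in time. -/
lemma exists_abs_suppFun_sub_le (hn : 1 ≤ n) (hq : 1 < q) (hfc : Continuous f)
    (hf : ∀ x ∈ Metric.sphere (0 : Eucl n) 1, 0 < f x)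
    (hK : ∀ t ∈ Set.Ico (0 : ℝ) T, IsSmoothBody (K t))
    (hflow : IsGaussChordFlow q 0 f (Set.Ico 0 T) K) {s s' : ℝ} (hs : 0 ≤ s) (hss' : s ≤ s')
    (hs' : s' < T) :
    ∃ C, ∀ t ∈ Set.Icc 0 s', ∀ x ∈ Metric.sphere (0 : Eucl n) 1,
      |suppFun (K t) x - suppFun (K s) x| ≤ C * |t - s| := by
  obtain ⟨r, R, hr, hR, hrR⟩ := exists_ball_bounds hf hK hflow ⟨hs.trans hss', hs'⟩
  obtain ⟨M, hM, hMle⟩ := exists_le_flowRHS_zero hn hq hfc hf hr hR.le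
  have hKs : IsSmoothBody (K s) := hK s ⟨hs, hss'.trans_lt hs'⟩
  have hK' : ∀ t ∈ Set.Icc 0 s', IsSmoothBody (K t) := fun t ht => hK t ⟨ht.1, ht.2.trans_lt hs'⟩
  obtain ⟨κ, hκ, hκle⟩ := hKs.exists_pos_le_curvDet
  have hspeed : ∀ a b, 0 ≤ a → b ≤ s' → ∀ t ∈ Set.Icc a b, ∀ x ∈ Metric.sphere (0 : Eucl n) 1,
      ∃ d, -M / curvDet (suppFun (K t)) x ≤ d ∧
        HasDerivWithinAt (fun s => suppFun (K s) x) d (Set.Icc a b) t := by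
    intro a b ha hb t ht x hx
    have ht' : t ∈ Set.Icc 0 s' := ⟨ha.trans ht.1, ht.2.trans hb⟩
    exact ⟨_, hMle (K t) (hK' t ht') (hrR t ht').1 (hrR t ht').2 x hx,
      (hflow t ⟨ht'.1, ht'.2.trans_lt hs'⟩ x hx).mono fun u hu =>
        ⟨ha.trans hu.1, (hu.2.trans hb).trans_lt hs'⟩⟩
  have hlow : ∀ t ∈ Set.Icc 0 s', ∀ x ∈ Metric.sphere (0 : Eucl n) 1, r ≤ suppFun (K t) x := by
    intro t ht x hx
    have := mul_norm_le_suppFun (hK' t ht).isCompact hr.le (hrR t ht).2 x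
    rwa [mem_sphere_zero_iff_norm.1 hx, mul_one] at this
  have hup : ∀ t ∈ Set.Icc 0 s', ∀ x ∈ Metric.sphere (0 : Eucl n) 1, suppFun (K t) x ≤ R :=
    fun t ht x hx => suppFun_le_of_subset_closedBall (hK' t ht).isCompact (hK' t ht).nonempty
      (hrR t ht).1 hx
  have hexp : ∀ u ∈ Set.Icc 0 s', Real.exp u - 1 ≤ Real.exp s' * u := by
    intro u hu
    have h1 := Real.add_one_le_exp (-u)
    have h2 : Real.exp u * Real.exp (-u) = 1 := by rw [← Real.exp_add]; simp
    have h3 : Real.exp u ≤ Real.exp s' := Real.exp_le_exp.2 hu.2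
    nlinarith [Real.exp_pos u, hu.1]
  set e : ℝ := Real.exp (-s') with he
  have he0 : 0 < e := Real.exp_pos _
  set a : ℝ := e * r / (2 * (e * r + R)) with ha
  have ha0 : 0 < a := by positivity
  have ha1 : a < 1 := by
    rw [ha, div_lt_one (by positivity)]
    nlinarith [mul_pos he0 hr]
  set b₀ : ℝ := (1 - a) * e with hb₀
  have hb₀0 : 0 < b₀ := mul_pos (by linarith) he0
  set m : ℝ := e * r / 2 with hmdef
  have hm0 : 0 < m := by positivity
  have hmeq : b₀ * r - a * R = m := by
    have : a * (e * r + R) = m := by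
      rw [ha, hmdef]
      field_simp
    rw [hb₀]
    linarith
  set B₁ : ℝ := (n + 1) * M / (1 ^ n * κ * r) + 1 with hB₁
  set B₂ : ℝ := (n + 1) * M / (b₀ ^ n * κ * m) + 1 with hB₂
  have hB₁0 : 0 ≤ B₁ := by positivity
  have hB₂0 : 0 ≤ B₂ := by positivity
  refine ⟨Real.exp s' * R + B₁ * R + (1 + B₂) * R / a, fun t ht x hx => ?_⟩
  have hsI : s ∈ Set.Icc 0 s' := ⟨hs, hss'⟩
  have hP1 : 0 ≤ Real.exp s' * R := by positivity
  have hP2 : 0 ≤ B₁ * R := by positivity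
  have hP3 : 0 ≤ (1 + B₂) * R / a := by positivity
  rcases le_total s t with hst | hst
  · rw [abs_of_nonneg (sub_nonneg.2 hst), abs_le]
    have hu : 0 ≤ t - s := sub_nonneg.2 hst
    constructor
    · have h := mul_one_sub_le_suppFun (K := K) (L := K s) (t₀ := s) (t₁ := s') (b := 1) (m := r)
        (fun u hu => hK' u ⟨hs.trans hu.1, hu.2⟩) hKs
        (fun u hu => (hrR u ⟨hs.trans hu.1, hu.2⟩).1) hM (hspeed s s' hs le_rfl) one_pos le_rfl 0 hr
        (fun z hz => by simpa using hlow s hsI z hz) hκ hκle (fun z _ => by simp) ⟨hst, ht.2⟩ hx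
      rw [← hB₁, inner_zero_left, add_zero, one_mul] at h
      have h1 : B₁ * (t - s) * suppFun (K s) x ≤ B₁ * (t - s) * R :=
        mul_le_mul_of_nonneg_left (hup s hsI x hx) (by positivity)
      nlinarith
    · have h := suppFun_le_exp_mul hf hK hflow hx hs hst (ht.2.trans_lt hs')
      have h1 := hexp (t - s) ⟨hu, by linarith [ht.2]⟩
      have h2 : (Real.exp (t - s) - 1) * suppFun (K s) x ≤ Real.exp s' * (t - s) * R :=
        mul_le_mul h1 (hup s hsI x hx) (hr.le.trans (hlow s hsI x hx)) (by positivity)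
      nlinarith
  · rw [abs_of_nonpos (sub_nonpos.2 hst), abs_le]
    have hu : 0 ≤ s - t := sub_nonneg.2 hst
    constructor
    · have h := suppFun_le_exp_mul hf hK hflow hx ht.1 hst (hss'.trans_lt hs')
      have h1 := hexp (s - t) ⟨hu, by linarith [ht.1]⟩
      have h2 : (Real.exp (s - t) - 1) * suppFun (K t) x ≤ Real.exp s' * (s - t) * R :=
        mul_le_mul h1 (hup t ht x hx) (hr.le.trans (hlow t ht x hx)) (by positivity)
      nlinarith
    · obtain ⟨p, hp, hpx⟩ := exists_inner_eq_suppFun (hK' t ht).isCompact (hK' t ht).nonempty x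
      have hpR : ‖p‖ ≤ R := mem_closedBall_zero_iff.1 ((hrR t ht).1 hp)
      set E : ℝ := Real.exp (-(s - t)) with hE
      have hE1 : E ≤ 1 := Real.exp_le_one_iff.2 (by linarith)
      have hEe : e ≤ E := Real.exp_le_exp.2 (by linarith [ht.1])
      have hE2 : 1 - (s - t) ≤ E := by linarith [Real.add_one_le_exp (-(s - t))]
      have hEs : ∀ z ∈ Metric.sphere (0 : Eucl n) 1, E * suppFun (K s) z ≤ suppFun (K t) z := by
        intro z hz
        have h := suppFun_le_exp_mul hf hK hflow hz ht.1 hst (hss'.trans_lt hs')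
        rw [hE, Real.exp_neg, inv_mul_le_iff₀ (Real.exp_pos _)]
        exact h
      have hbb : b₀ ≤ (1 - a) * E := mul_le_mul_of_nonneg_left hEe (by linarith)
      have h := mul_one_sub_le_suppFun (K := K) (L := K s) (t₀ := t) (t₁ := s)
        (b := (1 - a) * E) (m := m)
        (fun u hu => hK' u ⟨ht.1.trans hu.1, hu.2.trans hss'⟩) hKs
        (fun u hu => (hrR u ⟨ht.1.trans hu.1, hu.2.trans hss'⟩).1) hM (hspeed t s ht.1 hss')
        (hb₀0.trans_le hbb)
        (mul_le_one₀ (by linarith) (Real.exp_pos _).le hE1) (a • p) hm0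
        (fun z hz => by
          have h1 : b₀ * r ≤ (1 - a) * E * suppFun (K s) z :=
            mul_le_mul hbb (hlow s hsI z hz) hr.le (hb₀0.le.trans hbb)
          have h2 : -R ≤ ⟪p, z⟫ := by
            have := abs_le.1 (abs_real_inner_le_norm p z)
            rw [mem_sphere_zero_iff_norm.1 hz, mul_one] at this
            linarith [this.1]
          rw [real_inner_smul_left]
          linarith [mul_le_mul_of_nonneg_left h2 ha0.le]) hκ hκle
        (fun z hz => by
          have h1 : ⟪p, z⟫ ≤ suppFun (K t) z := by
            rw [real_inner_comm]
            exact inner_le_suppFun (hK' t ht).isCompact z hp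
          rw [real_inner_smul_left]
          linarith [mul_le_mul_of_nonneg_left (hEs z hz) (sub_nonneg.2 ha1.le),
            mul_le_mul_of_nonneg_left h1 ha0.le]) ⟨hst, le_rfl⟩ hx
      rw [real_inner_smul_left, real_inner_comm, hpx] at h
      set W : ℝ := (1 - a) * E * suppFun (K s) x + a * suppFun (K t) x with hW
      have hs1 := hEs x hx
      have hWR : W ≤ R := by
        linarith [hup t ht x hx, mul_le_mul_of_nonneg_left hs1 (sub_nonneg.2 ha1.le)]
      have hW0 : 0 ≤ W := by
        have := hlow s hsI x hx
        have := hlow t ht x hx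
        have : 0 ≤ suppFun (K s) x := by linarith
        have : 0 ≤ suppFun (K t) x := by linarith
        have := hb₀0.trans_le hbb
        positivity
      have hBB : (n + 1) * M / (((1 - a) * E) ^ n * κ * m) + 1 ≤ B₂ := by
        rw [hB₂]
        gcongr
      have h3 : W - B₂ * (s - t) * R ≤ suppFun (K s) x := by
        refine le_trans ?_ h
        have h4 : ((n + 1) * M / (((1 - a) * E) ^ n * κ * m) + 1) * (s - t) * W
            ≤ B₂ * (s - t) * R :=
          mul_le_mul (mul_le_mul_of_nonneg_right hBB hu) hWR hW0 (by positivity)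
        linarith
      have h5 : (1 - (s - t)) * suppFun (K s) x ≤ E * suppFun (K s) x :=
        mul_le_mul_of_nonneg_right hE2 (hr.le.trans (hlow s hsI x hx))
      have h6 : a * (suppFun (K t) x - suppFun (K s) x) ≤ (1 + B₂) * R * (s - t) := by
        have h7 : (1 - a) * ((1 - (s - t)) * suppFun (K s) x) ≤ (1 - a) * (E * suppFun (K s) x) :=
          mul_le_mul_of_nonneg_left h5 (by linarith)
        have h8 : (1 - a) * ((s - t) * suppFun (K s) x) ≤ 1 * ((s - t) * R) :=
          mul_le_mul (by linarith) (mul_le_mul_of_nonneg_left (hup s hsI x hx) hu)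
            (mul_nonneg hu (hr.le.trans (hlow s hsI x hx))) zero_le_one
        linarith
      have h9 : suppFun (K t) x - suppFun (K s) x ≤ (1 + B₂) * R / a * (s - t) := by
        rw [div_mul_eq_mul_div, le_div_iff₀ ha0]
        linarith
      linarith [mul_nonneg hP1 hu, mul_nonneg hP2 hu]

end FlowLipschitz

section EntropyDerivative

variable {n : ℕ} {q T : ℝ} {f : Eucl n → ℝ}

lemma integrableOn_sphere (hn : 1 ≤ n) {g : Eucl n → ℝ}
    (hg : ContinuousOn g (Metric.sphere (0 : Eucl n) 1)) :
    IntegrableOn g (Metric.sphere (0 : Eucl n) 1) μH[(n : ℝ) - 1] := by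
  have := isFiniteMeasure_hausdorffMeasure_sphere hn
  obtain ⟨C, hC⟩ := (isCompact_sphere (0 : Eucl n) 1).exists_bound_of_continuousOn hg
  exact Integrable.of_bound (hg.aestronglyMeasurable Metric.isClosed_sphere.measurableSet) C
    (ae_restrict_of_forall_mem Metric.isClosed_sphere.measurableSet hC)

lemma eq_zero_of_setIntegral_sphere_eq_zero (hn : 1 ≤ n) {g : Eucl n → ℝ}
    (hg : ContinuousOn g (Metric.sphere (0 : Eucl n) 1))
    (hg0 : ∀ x ∈ Metric.sphere (0 : Eucl n) 1, 0 ≤ g x)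
    (hgint : ∫ x in Metric.sphere (0 : Eucl n) 1, g x ∂μH[(n : ℝ) - 1] = 0) :
    ∀ x ∈ Metric.sphere (0 : Eucl n) 1, g x = 0 := by
  have hS : MeasurableSet (Metric.sphere (0 : Eucl n) 1) := Metric.isClosed_sphere.measurableSet
  have hae := (setIntegral_eq_zero_iff_of_nonneg_ae (ae_restrict_of_forall_mem hS hg0)
    (integrableOn_sphere hn hg)).1 hgint
  intro x hx
  by_contra hgx
  obtain ⟨U, hU, hUeq⟩ := continuousOn_iff'.1 hg {(0 : ℝ)}ᶜ isOpen_compl_singleton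
  have hxU : x ∈ U := (hUeq.subset ⟨hgx, hx⟩).1
  refine measure_sphere_inter_pos hn hU hxU (mem_sphere_zero_iff_norm.1 hx) ?_
  have hae' : ∀ᵐ y ∂(μH[(n : ℝ) - 1].restrict (Metric.sphere (0 : Eucl n) 1)), y ∉ U := by
    filter_upwards [hae, ae_restrict_mem hS] with y hy hyS hyU
    exact (hUeq.superset ⟨hyU, hyS⟩).1 hy
  simpa [ae_iff] using hae'

lemma setIntegral_sphere_pos (hn : 1 ≤ n) {g : Eucl n → ℝ}
    (hg : ContinuousOn g (Metric.sphere (0 : Eucl n) 1))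
    (hg0 : ∀ x ∈ Metric.sphere (0 : Eucl n) 1, 0 < g x) :
    0 < ∫ x in Metric.sphere (0 : Eucl n) 1, g x ∂μH[(n : ℝ) - 1] := by
  refine lt_of_le_of_ne (setIntegral_nonneg Metric.isClosed_sphere.measurableSet
    fun x hx => (hg0 x hx).le) fun h => ?_
  have : Nontrivial (Eucl n) := by
    have : NeZero n := ⟨by omega⟩
    infer_instance
  obtain ⟨x, hx⟩ := NormedSpace.sphere_nonempty (x := (0 : Eucl n)).2 zero_le_one
  exact (hg0 x hx).ne' (eq_zero_of_setIntegral_sphere_eq_zero hn hg (fun y hy => (hg0 y hy).le)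
    h.symm x hx)

lemma abs_log_sub_log_le {r a b : ℝ} (hr : 0 < r) (ha : r ≤ a) (hb : r ≤ b) :
    |Real.log a - Real.log b| ≤ |a - b| / r := by
  have key : ∀ {a b : ℝ}, r ≤ a → r ≤ b → Real.log a - Real.log b ≤ |a - b| / r := by
    intro a b ha hb
    have ha0 := hr.trans_le ha
    have hb0 := hr.trans_le hb
    rw [← Real.log_div ha0.ne' hb0.ne']
    calc Real.log (a / b) ≤ a / b - 1 := Real.log_le_sub_one_of_pos (by positivity)
      _ = (a - b) / b := by field_simp
      _ ≤ |a - b| / b := div_le_div_of_nonneg_right (le_abs_self _) hb0.le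
      _ ≤ |a - b| / r := div_le_div_of_nonneg_left (abs_nonneg _) hr hb
  rw [abs_le]
  refine ⟨?_, key ha hb⟩
  have := key hb ha
  rw [abs_sub_comm] at this
  linarith

/-- Differentiation of the entropy `∫ f log h` under the integral sign along the flow. -/
lemma hasDerivWithinAt_setIntegral_log_suppFun {K : ℝ → Set (Eucl n)} (hn : 1 ≤ n) (hq : 1 < q)
    (hfc : Continuous f) (hf : ∀ x ∈ Metric.sphere (0 : Eucl n) 1, 0 < f x)
    (hK : ∀ t ∈ Set.Ico (0 : ℝ) T, IsSmoothBody (K t))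
    (hflow : IsGaussChordFlow q 0 f (Set.Ico 0 T) K) {s : ℝ} (hs : s ∈ Set.Ico 0 T) :
    HasDerivWithinAt (fun t => ∫ x in Metric.sphere (0 : Eucl n) 1,
        f x * Real.log (suppFun (K t) x) ∂μH[(n : ℝ) - 1])
      (∫ x in Metric.sphere (0 : Eucl n) 1,
        f x * (flowRHS q 0 f (K s) x / suppFun (K s) x) ∂μH[(n : ℝ) - 1]) (Set.Ico 0 T) s := by
  have hS : MeasurableSet (Metric.sphere (0 : Eucl n) 1) := Metric.isClosed_sphere.measurableSet
  obtain ⟨s', hss', hs'T⟩ := exists_between hs.2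
  obtain ⟨C, hC⟩ := exists_abs_suppFun_sub_le hn hq hfc hf hK hflow hs.1 hss'.le hs'T
  obtain ⟨r, R, hr, hR, hrR⟩ := exists_ball_bounds hf hK hflow ⟨hs.1.trans hss'.le, hs'T⟩
  have hlow : ∀ t ∈ Set.Icc 0 s', ∀ x ∈ Metric.sphere (0 : Eucl n) 1, r ≤ suppFun (K t) x := by
    intro t ht x hx
    have := mul_norm_le_suppFun (hK t ⟨ht.1, ht.2.trans_lt hs'T⟩).isCompact hr.le (hrR t ht).2 x
    rwa [mem_sphere_zero_iff_norm.1 hx, mul_one] at this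
  have hlogc : ∀ t ∈ Set.Ico 0 T, ContinuousOn (fun x => f x * Real.log (suppFun (K t) x))
      (Metric.sphere (0 : Eucl n) 1) := by
    intro t ht
    refine hfc.continuousOn.mul (ContinuousOn.log ((hK t ht).continuousOn_suppFun.mono
      fun x hx => ne_zero_of_mem_unit_sphere ⟨x, hx⟩) fun x hx => ?_)
    exact ((hK t ht).suppFun_pos (ne_zero_of_mem_unit_sphere ⟨x, hx⟩)).ne'
  have hIcc : ∀ᶠ t in 𝓝[Set.Ico 0 T \ {s}] s, t ∈ Set.Icc 0 s' ∧ t ≠ s := by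
    filter_upwards [self_mem_nhdsWithin, nhdsWithin_le_nhds (Iio_mem_nhds hss')] with t ht hts
    exact ⟨⟨ht.1.1, le_of_lt hts⟩, ht.2⟩
  rw [hasDerivWithinAt_iff_tendsto_slope]
  have hlim := tendsto_integral_filter_of_dominated_convergence
    (μ := μH[(n : ℝ) - 1].restrict (Metric.sphere (0 : Eucl n) 1))
    (l := 𝓝[Set.Ico 0 T \ {s}] s)
    (F := fun t x => slope (fun u => f x * Real.log (suppFun (K u) x)) s t)
    (f := fun x => f x * (flowRHS q 0 f (K s) x / suppFun (K s) x))
    (fun x => |f x| * (C / r)) ?_ ?_ ?_ ?_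
  · refine hlim.congr' ?_
    filter_upwards [hIcc] with t ht
    have htT : t ∈ Set.Ico 0 T := ⟨ht.1.1, ht.1.2.trans_lt hs'T⟩
    simp only [slope_def_field]
    rw [integral_div, integral_sub (integrableOn_sphere hn (hlogc t htT))
      (integrableOn_sphere hn (hlogc s hs))]
  · filter_upwards [hIcc] with t ht
    have htT : t ∈ Set.Ico 0 T := ⟨ht.1.1, ht.1.2.trans_lt hs'T⟩
    simp only [slope_def_field]
    exact (((hlogc t htT).sub (hlogc s hs)).div_const _).aestronglyMeasurable hS
  · filter_upwards [hIcc] with t ht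
    refine ae_restrict_of_forall_mem hS fun x hx => ?_
    have hts : 0 < |t - s| := abs_pos.2 (sub_ne_zero.2 ht.2)
    have h1 := abs_log_sub_log_le hr (hlow t ht.1 x hx) (hlow s ⟨hs.1, hss'.le⟩ x hx)
    have h2 := div_le_div_of_nonneg_right (hC t ht.1 x hx) hr.le
    rw [slope_def_field, ← mul_sub, mul_div_assoc, Real.norm_eq_abs, abs_mul, abs_div]
    refine mul_le_mul_of_nonneg_left ?_ (abs_nonneg _)
    rw [div_le_iff₀ hts]
    calc _ ≤ C * |t - s| / r := h1.trans h2
      _ = C / r * |t - s| := by ring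
  · exact integrableOn_sphere hn (by fun_prop)
  · refine ae_restrict_of_forall_mem hS fun x hx => ?_
    have h1 := ((hflow s hs x hx).log
      ((hK s hs).suppFun_pos (ne_zero_of_mem_unit_sphere ⟨x, hx⟩)).ne').const_mul (f x)
    exact hasDerivWithinAt_iff_tendsto_slope.1 h1

lemma setIntegral_flowRHS_div_suppFun {K : Set (Eucl n)} (hn : 1 ≤ n) (hq : 1 < q)
    (hfc : Continuous f) (hf : ∀ x ∈ Metric.sphere (0 : Eucl n) 1, 0 < f x)
    (hK : IsSmoothBody K) :
    (∫ x in Metric.sphere (0 : Eucl n) 1,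
        f x * (flowRHS q 0 f K x / suppFun K x) ∂μH[(n : ℝ) - 1]) ≤ 0 ∧
      ((∫ x in Metric.sphere (0 : Eucl n) 1,
          f x * (flowRHS q 0 f K x / suppFun K x) ∂μH[(n : ℝ) - 1]) = 0 ↔
        ∀ x ∈ Metric.sphere (0 : Eucl n) 1, (theta q 0 f K)⁻¹ *
          Vtilde q K (gradient (suppFun K) x) * suppFun K x * curvDet (suppFun K) x = f x) := by
  have hS : MeasurableSet (Metric.sphere (0 : Eucl n) 1) := Metric.isClosed_sphere.measurableSet
  have hS0 : Metric.sphere (0 : Eucl n) 1 ⊆ {(0 : Eucl n)}ᶜ := fun x hx =>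
    ne_zero_of_mem_unit_sphere ⟨x, hx⟩
  set S : Set (Eucl n) := Metric.sphere (0 : Eucl n) 1 with hSdef
  set J : Eucl n → ℝ := fun x =>
    Vtilde q K (gradient (suppFun K) x) * suppFun K x * curvDet (suppFun K) x with hJ
  set θ : ℝ := theta q 0 f K with hθ
  have hVc := continuous_Vtilde hn hq hK.isCompact hK.convex
  have hJc : ContinuousOn J S :=
    ((hVc.comp_continuousOn (hK.continuousOn_gradient.mono hS0)).mul
      (hK.continuousOn_suppFun.mono hS0)).mul (hK.continuousOn_curvDet.mono hS0)
  have hVpos : ∀ x ∈ S, 0 < Vtilde q K (gradient (suppFun K) x) := by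
    obtain ⟨R, -, hR⟩ := hK.isCompact.isBounded.exists_pos_norm_le
    obtain ⟨r, hr0, hr⟩ := exists_closedBall_subset hK.zero_mem_interior
    obtain ⟨c, hc0, hc⟩ := exists_le_Vtilde hn hq hr0 (R := R) (n := n)
    intro x hx
    refine hc0.trans_le (hc K hK.isCompact (fun y hy => mem_closedBall_zero_iff.2 (hR y hy)) hr _
      ?_ (hR _ (hK.gradient_mem (hS0 hx))))
    have h1 := real_inner_le_norm x (gradient (suppFun K) x)
    have h2 := mul_norm_le_suppFun hK.isCompact hr0.le hr x
    rw [hK.inner_gradient (hS0 hx), mem_sphere_zero_iff_norm.1 hx, one_mul] at h1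
    rw [mem_sphere_zero_iff_norm.1 hx, mul_one] at h2
    exact h2.trans h1
  have hJpos : ∀ x ∈ S, 0 < J x := fun x hx =>
    mul_pos (mul_pos (hVpos x hx) (hK.suppFun_pos (hS0 hx))) (hK.curvDet_pos hx)
  have hApos := setIntegral_sphere_pos hn hfc.continuousOn hf
  have hJint := setIntegral_sphere_pos hn hJc hJpos
  have hθeq : θ = (∫ x in S, J x ∂μH[(n : ℝ) - 1]) / ∫ x in S, f x ∂μH[(n : ℝ) - 1] := by
    rw [hθ, theta, hK.setIntegral_radial_eq hn hVc]
    simp only [Real.rpow_zero, one_mul, hJ, hSdef]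
  have hθpos : 0 < θ := hθeq ▸ div_pos hJint hApos
  set G : Eucl n → ℝ := fun x => θ * (f x - θ⁻¹ * J x) ^ 2 / J x with hG
  have hGc : ContinuousOn G S :=
    (continuousOn_const.mul ((hfc.continuousOn.sub (continuousOn_const.mul hJc)).pow 2)).div hJc
      fun x hx => (hJpos x hx).ne'
  have hG0 : ∀ x ∈ S, 0 ≤ G x := fun x hx =>
    div_nonneg (mul_nonneg hθpos.le (sq_nonneg _)) (hJpos x hx).le
  have hd : (∫ x in S, f x * (flowRHS q 0 f K x / suppFun K x) ∂μH[(n : ℝ) - 1]) =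
      -∫ x in S, G x ∂μH[(n : ℝ) - 1] := by
    have h1 : ∀ x ∈ S, f x * (flowRHS q 0 f K x / suppFun K x) =
        (θ⁻¹ * J x - f x) - G x := by
      intro x hx
      have hV := (hVpos x hx).ne'
      have hH := (hK.suppFun_pos (hS0 hx)).ne'
      have hc := (hK.curvDet_pos hx).ne'
      have hθ0 := hθpos.ne'
      rw [flowRHS_zero_eq, ← hθ]
      simp only [hG, hJ]
      field_simp
      ring
    have hi1 : IntegrableOn (fun x => θ⁻¹ * J x) S μH[(n : ℝ) - 1] :=
      integrableOn_sphere hn (continuousOn_const.mul hJc)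
    have hi3 : IntegrableOn (fun x => θ⁻¹ * J x - f x) S μH[(n : ℝ) - 1] :=
      integrableOn_sphere hn ((continuousOn_const.mul hJc).sub hfc.continuousOn)
    have hi2 : IntegrableOn f S μH[(n : ℝ) - 1] := integrableOn_sphere hn hfc.continuousOn
    rw [setIntegral_congr_fun hS h1, integral_sub hi3 (integrableOn_sphere hn hGc),
      integral_sub hi1 hi2, integral_const_mul, hθeq, inv_div, div_mul_cancel₀ _ hJint.ne',
      sub_self, zero_sub]
  rw [hd]
  refine ⟨neg_nonpos.2 (setIntegral_nonneg hS hG0), ?_⟩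
  have hiff : ∀ x ∈ S, (G x = 0 ↔ θ⁻¹ * Vtilde q K (gradient (suppFun K) x) * suppFun K x *
      curvDet (suppFun K) x = f x) := by
    intro x hx
    have hJx : θ⁻¹ * Vtilde q K (gradient (suppFun K) x) * suppFun K x *
        curvDet (suppFun K) x = θ⁻¹ * J x := by
      simp only [hJ]
      ring
    rw [hJx]
    simp only [hG, div_eq_zero_iff, mul_eq_zero, hθpos.ne', (hJpos x hx).ne', false_or, or_false,
      pow_eq_zero_iff two_ne_zero, sub_eq_zero]
    exact eq_comm
  rw [neg_eq_zero]
  constructor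
  · exact fun h x hx => (hiff x hx).1 (eq_zero_of_setIntegral_sphere_eq_zero hn hGc hG0 h x hx)
  · exact fun h => setIntegral_eq_zero_of_forall_eq_zero fun x hx => (hiff x hx).2 (h x hx)

end EntropyDerivative

/-- (Lemma 3.2, case `p = 0`: the functional
`Φ(Ω_t) = ∫_{S^{n-1}} f log h` is non-increasing along the flow, with equality at a time
`t` exactly when `h(·,t)` solves `τ₂ Ṽ_{γ,q} h det(∇²h + hI) = f` with `τ₂ = 1/θ(t)`). -/
theorem functional_nonincreasing_p_zero
    (n : ℕ) (q : ℝ) (hq : 1 < q) (T : ℝ) (hT : 0 < T)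
    (f : Eucl n → ℝ) (hf : ContDiff ℝ (⊤ : ℕ∞) f)
    (hfpos : ∀ x ∈ Metric.sphere (0 : Eucl n) 1, 0 < f x)
    (hfeven : ∀ x : Eucl n, f (-x) = f x)
    (K : ℝ → Set (Eucl n))
    (hsmooth : ∀ t ∈ Set.Ico (0 : ℝ) T, IsSmoothBody (K t))
    (hflow : IsGaussChordFlow q 0 f (Set.Ico 0 T) K) :
    ∀ t ∈ Set.Ico (0 : ℝ) T, ∃ d : ℝ,
      HasDerivWithinAt (fun s =>
          ∫ x in Metric.sphere (0 : Eucl n) 1,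
            f x * Real.log (suppFun (K s) x) ∂μH[(n : ℝ) - 1])
        d (Set.Ico 0 T) t ∧
      d ≤ 0 ∧
      (d = 0 ↔ ∀ x ∈ Metric.sphere (0 : Eucl n) 1,
        (theta q 0 f (K t))⁻¹ * Vtilde q (K t) (gradient (suppFun (K t)) x) *
          suppFun (K t) x * curvDet (suppFun (K t)) x = f x) := by
  intro t ht
  rcases Nat.eq_zero_or_pos n with rfl | hn
  · have hempty : Metric.sphere (0 : Eucl 0) 1 = ∅ :=
      Metric.sphere_eq_empty_of_subsingleton one_ne_zero
    refine ⟨0, ?_, le_rfl, ?_⟩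
    · simp only [hempty, Measure.restrict_empty, integral_zero_measure]
      exact hasDerivWithinAt_const _ _ _
    · simp [hempty]
  · exact ⟨_, hasDerivWithinAt_setIntegral_log_suppFun hn hq hf.continuous hfpos hsmooth hflow ht,
      setIntegral_flowRHS_div_suppFun hn hq hf.continuous hfpos (hsmooth t ht)⟩
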